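/- Let w1 and w2 be non-trivial words. There exists N such that for all n ≥ N, every finite quasisimple group G with G/Z(G) isomorphic to the alternating group A_n satisfies w1(G)·w2(G) = G. -/

import Mathlib

/-- The set of values of the word `w` in the group `G`: the image of the word map
`G^d → G` induced by substitution. -/
def wordImage {d : ℕ} (w : FreeGroup (Fin d)) (G : Type*) [Group G] : Set G :=
  Set.range fun f : Fin d → G => FreeGroup.lift f w

/-- A group is quasisimple if it is perfect and its quotient by its center is a
non-abelian simple group. -/
def IsQuasisimple (G : Type*) [Group G] : Prop :=
  commutator G = ⊤ ∧ IsSimpleGroup (G ⧸ Subgroup.center G) ∧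
    ∃ a b : G ⧸ Subgroup.center G, a * b ≠ b * a

open Equiv Equiv.Perm
open scoped commutatorElement

section ThreeCyc
variable {α : Type*} [DecidableEq α]

/-- The three-cycle `a ↦ b ↦ c ↦ a`. -/
def threeCyc (a b c : α) : Perm α := swap a b * swap b c

theorem conj_threeCyc (σ : Perm α) (a b c : α) :
    σ * threeCyc a b c * σ⁻¹ = threeCyc (σ a) (σ b) (σ c) := by
  rw [threeCyc, threeCyc, swap_apply_apply, swap_apply_apply]
  group

theorem threeCyc_apply_fst {a b c : α} (h : [a, b, c].Nodup) : threeCyc a b c a = b := by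
  simp_all [threeCyc, swap_apply_of_ne_of_ne]

theorem threeCyc_apply_snd {a b c : α} (h : [a, b, c].Nodup) : threeCyc a b c b = c := by
  simp_all [threeCyc, swap_apply_of_ne_of_ne, eq_comm]

theorem threeCyc_apply_thd (a b c : α) : threeCyc a b c c = a := by
  simp [threeCyc]

theorem threeCyc_apply_of_ne {a b c x : α} (ha : x ≠ a) (hb : x ≠ b) (hc : x ≠ c) :
    threeCyc a b c x = x := by
  simp [threeCyc, swap_apply_of_ne_of_ne, *]

theorem threeCyc_inv {a b c : α} (h : [a, b, c].Nodup) :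
    (threeCyc a b c)⁻¹ = threeCyc a c b := by
  rw [inv_eq_iff_mul_eq_one]
  ext x
  simp only [threeCyc, Perm.mul_apply, swap_apply_def, Perm.one_apply]
  simp at h
  grind

theorem commutator_threeCyc {a b c d e : α} (h : [a, b, c, d, e].Nodup) :
    ⁅threeCyc a b d, threeCyc a c e⁆ = threeCyc a b c := by
  have h1 : [a, b, d].Nodup := by simp_all
  have h2 : [a, c, e].Nodup := by simp_all
  rw [commutatorElement_def, conj_threeCyc, threeCyc_inv h2, threeCyc_apply_fst h1,
    threeCyc_apply_of_ne, threeCyc_apply_of_ne]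
  · ext x
    simp only [threeCyc, Perm.mul_apply, swap_apply_def]
    simp at h
    grind
  all_goals simp at h; grind

theorem sign_threeCyc [Fintype α] {a b c : α} (h : [a, b, c].Nodup) :
    sign (threeCyc a b c) = 1 := by
  simp at h
  rw [threeCyc, Perm.sign_mul, sign_swap (by grind), sign_swap (by grind), Int.units_mul_self]

theorem isThreeCycle_threeCyc [Fintype α] {a b c : α} (h : [a, b, c].Nodup) :
    IsThreeCycle (threeCyc a b c) := by
  simp at h
  rw [threeCyc, swap_comm a b]
  exact isThreeCycle_swap_mul_swap_same (by grind) (by grind) (by grind)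

theorem threeCyc_pow_three [Fintype α] {a b c : α} (h : [a, b, c].Nodup) :
    threeCyc a b c ^ 3 = 1 := by
  rw [← (isThreeCycle_threeCyc h).orderOf, pow_orderOf_eq_one]

theorem exists_notMem_of_length_lt [Fintype α] (l : List α) (h : l.length < Fintype.card α) :
    ∃ x, x ∉ l := by
  by_contra! hl
  have : Finset.univ ⊆ l.toFinset := fun x _ => by simpa using hl x
  have := Finset.card_le_card this
  have := l.toFinset_card_le
  simp at *
  omega

end ThreeCyc

/-- A homomorphism onto the alternating group with central kernel. -/
structure IsAltCover {G α : Type*} [Group G] [Fintype α] [DecidableEq α] (π : G →* Perm α) :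
    Prop where
  exists_map_eq : ∀ σ, sign σ = 1 → ∃ g, π g = σ
  sign_map : ∀ g, sign (π g) = 1
  mem_center : ∀ g, π g = 1 → g ∈ Subgroup.center G

/-- The lift of the three-cycle `threeCyc a b c` obtained from its expression as a commutator of
three-cycles. -/
noncomputable def commLift {G α : Type*} [Group G] [DecidableEq α] (π : G →* Perm α)
    (a b c d e : α) : G :=
  ⁅Function.invFun π (threeCyc a b d), Function.invFun π (threeCyc a c e)⁆

namespace IsAltCover
variable {G α : Type*} [Group G] [Fintype α] [DecidableEq α] {π : G →* Perm α}

theorem commute_of_map_eq_one (hπ : IsAltCover π) {z : G} (hz : π z = 1) (g : G) : Commute z g :=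
  (Subgroup.mem_center_iff.1 (hπ.mem_center z hz) g).symm

theorem commutator_congr (hπ : IsAltCover π) {g g' h h' : G} (hg : π g = π g') (hh : π h = π h') :
    ⁅g, h⁆ = ⁅g', h'⁆ := by
  obtain ⟨z, rfl, hz⟩ : ∃ z, g' = g * z ∧ π z = 1 := ⟨g⁻¹ * g', by simp, by simp [hg]⟩
  obtain ⟨w, rfl, hw⟩ : ∃ z, h' = h * z ∧ π z = 1 := ⟨h⁻¹ * h', by simp, by simp [hh]⟩
  have h1 := hπ.commute_of_map_eq_one hz
  have h2 := hπ.commute_of_map_eq_one hw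
  simp only [commutatorElement_def, mul_inv_rev]
  have e1 : g * z * (h * w) = g * h * w * z := by
    rw [mul_assoc g z, (h1 (h * w)).eq]; simp [mul_assoc]
  have e2 : z * (z⁻¹ * g⁻¹) = g⁻¹ := by simp
  calc g * h * g⁻¹ * h⁻¹ = g * h * w * (g⁻¹ * w⁻¹) * h⁻¹ := by
        rw [((h2 g⁻¹).inv_left.eq).symm]; group
    _ = g * z * (h * w) * (z⁻¹ * g⁻¹) * (w⁻¹ * h⁻¹) := by rw [e1]; group

theorem map_invFun (hπ : IsAltCover π) {σ : Perm α} (h : sign σ = 1) :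
    π (Function.invFun π σ) = σ :=
  Function.invFun_eq (hπ.exists_map_eq σ h)

theorem map_commLift (hπ : IsAltCover π) {a b c d e : α} (h : [a, b, c, d, e].Nodup) :
    π (commLift π a b c d e) = threeCyc a b c := by
  rw [commLift, map_commutatorElement, hπ.map_invFun (sign_threeCyc (by simp_all)),
    hπ.map_invFun (sign_threeCyc (by simp_all)), commutator_threeCyc h]

theorem conj_commLift (hπ : IsAltCover π) (g : G) {a b c d e : α} (h : [a, b, c, d, e].Nodup) :
    g * commLift π a b c d e * g⁻¹ = commLift π (π g a) (π g b) (π g c) (π g d) (π g e) := by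
  have h1 : sign (threeCyc a b d) = 1 := sign_threeCyc (by simp_all)
  have h2 : sign (threeCyc a c e) = 1 := sign_threeCyc (by simp_all)
  rw [commLift, commLift, show ∀ x y : G, g * ⁅x, y⁆ * g⁻¹ = ⁅g * x * g⁻¹, g * y * g⁻¹⁆ by
    intro x y; simp only [commutatorElement_def]; group]
  apply hπ.commutator_congr
  · rw [← conj_threeCyc, hπ.map_invFun (by simp [h1])]
    simp [hπ.map_invFun h1]
  · rw [← conj_threeCyc, hπ.map_invFun (by simp [h2])]
    simp [hπ.map_invFun h2]

omit [Fintype α] in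
theorem commLift_inv (a b c d e : α) : (commLift π a b c d e)⁻¹ = commLift π a c b e d := by
  rw [commLift, commLift, commutatorElement_inv]

theorem commLift_congr_snd (hπ : IsAltCover π) (hα : 8 ≤ Fintype.card α) {a b c d e e' : α}
    (h : [a, b, c, d, e, e'].Nodup) : commLift π a b c d e = commLift π a b c d e' := by
  obtain ⟨f, hf⟩ := exists_notMem_of_length_lt [a, b, c, d, e, e'] (by simp; omega)
  obtain ⟨i, hi⟩ := exists_notMem_of_length_lt [a, b, c, d, e, e', f] (by simp; omega)
  have hg : [a, b, c, d, e].Nodup := by simp at h ⊢; grind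
  have hh : [e, e', f, d, i].Nodup := by simp at h hf hi ⊢; grind
  have hπh := hπ.map_commLift hh
  have hπg := hπ.map_commLift hg
  have c1 : commLift π a b c d e * commLift π e e' f d i * (commLift π a b c d e)⁻¹ =
      commLift π e e' f d i := by
    rw [hπ.conj_commLift _ hh, hπg]
    congr 1 <;> · apply threeCyc_apply_of_ne <;> · simp at h hf hi; grind
  have c2 := hπ.conj_commLift (commLift π e e' f d i) hg
  rw [hπh, threeCyc_apply_of_ne, threeCyc_apply_of_ne, threeCyc_apply_of_ne, threeCyc_apply_of_ne,
    threeCyc_apply_fst] at c2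
  · rw [← c2, ← mul_inv_eq_iff_eq_mul.1 c1]
    group
  all_goals simp at h hf hi ⊢; grind

theorem commLift_congr_fst (hπ : IsAltCover π) (hα : 8 ≤ Fintype.card α) {a b c d e d' : α}
    (h : [a, b, c, d, e, d'].Nodup) : commLift π a b c d e = commLift π a b c d' e := by
  rw [← inv_inj, commLift_inv, commLift_inv]
  apply hπ.commLift_congr_snd hα
  simp at h ⊢; grind

theorem commLift_congr (hπ : IsAltCover π) (hα : 8 ≤ Fintype.card α) {a b c d e d' e' : α}
    (h : [a, b, c, d, e].Nodup) (h' : [a, b, c, d', e'].Nodup) :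
    commLift π a b c d e = commLift π a b c d' e' := by
  obtain ⟨f, hf⟩ := exists_notMem_of_length_lt [a, b, c, d, e, d', e'] (by simp; omega)
  rw [hπ.commLift_congr_snd hα (e' := f) (by simp at h h' hf ⊢; grind),
    hπ.commLift_congr_snd hα (a := a) (e := e') (e' := f) (by simp at h h' hf ⊢; grind)]
  by_cases hd : d = d'
  · rw [hd]
  · exact hπ.commLift_congr_fst hα (by simp at h h' hf ⊢; grind)

/-- A system of lifts of the three-cycles that is equivariant under conjugation. -/
structure IsThreeCycSection (π : G →* Perm α) (s : α → α → α → G) : Prop where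
  map_eq : ∀ {a b c : α}, [a, b, c].Nodup → π (s a b c) = threeCyc a b c
  conj_eq : ∀ (g : G) {a b c : α}, [a, b, c].Nodup →
    g * s a b c * g⁻¹ = s (π g a) (π g b) (π g c)
  inv_eq : ∀ {a b c : α}, [a, b, c].Nodup → (s a b c)⁻¹ = s a c b
  rotate : ∀ {a b c : α}, [a, b, c].Nodup → s b c a = s a b c
  pow_three : ∀ {a b c : α}, [a, b, c].Nodup → s a b c ^ 3 = 1

theorem exists_isThreeCycSection (hπ : IsAltCover π) (hα : 8 ≤ Fintype.card α) :
    ∃ s, IsThreeCycSection π s := by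
  have hex : ∀ a b c : α, ∃ p : α × α, [a, b, c].Nodup → [a, b, c, p.1, p.2].Nodup := by
    intro a b c
    obtain ⟨f, hf⟩ := exists_notMem_of_length_lt [a, b, c] (by simp; omega)
    obtain ⟨i, hi⟩ := exists_notMem_of_length_lt [a, b, c, f] (by simp; omega)
    exact ⟨(f, i), fun h => by simp at h hf hi ⊢; grind⟩
  choose p hp using hex
  obtain ⟨t, ht⟩ : ∃ t : α → α → α → G, ∀ {a b c d e}, [a, b, c, d, e].Nodup →
      t a b c = commLift π a b c d e :=
    ⟨fun a b c => commLift π a b c (p a b c).1 (p a b c).2, fun {a b c d e} h =>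
      hπ.commLift_congr hα (hp _ _ _ (by simp at h ⊢; grind)) h⟩
  have map_eq : ∀ {a b c : α}, [a, b, c].Nodup → π (t a b c) = threeCyc a b c := fun h => by
    rw [ht (hp _ _ _ h), hπ.map_commLift (hp _ _ _ h)]
  have conj_eq : ∀ (g : G) {a b c : α}, [a, b, c].Nodup →
      g * t a b c * g⁻¹ = t (π g a) (π g b) (π g c) := fun g a b c h => by
    have h' := hp a b c h
    rw [ht h', hπ.conj_commLift g h', ht]
    exact h'.map (π g).injective
  have inv_eq : ∀ {a b c : α}, [a, b, c].Nodup → (t a b c)⁻¹ = t a c b := fun {a b c} h => by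
    have h' := hp a b c h
    rw [ht h', commLift_inv, ht]
    simp at h' ⊢; grind
  have rotate : ∀ {a b c : α}, [a, b, c].Nodup → t b c a = t a b c := fun {a b c} h => by
    have := conj_eq (t a b c) h
    rw [map_eq h, threeCyc_apply_fst h, threeCyc_apply_snd h, threeCyc_apply_thd] at this
    simpa using this.symm
  have pow_six : ∀ {a b c : α}, [a, b, c].Nodup → t a b c ^ 6 = 1 := fun {a b c} h => by
    have h' := hp a b c h
    obtain ⟨g, hg⟩ := hπ.exists_map_eq (swap (p a b c).1 (p a b c).2 * swap b c) (by
      simp at h'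
      rw [Perm.sign_mul, sign_swap (by grind), sign_swap (by grind), Int.units_mul_self])
    have e := conj_eq g h
    have e1 : π g a = a := by
      rw [hg, Perm.mul_apply, swap_apply_of_ne_of_ne, swap_apply_of_ne_of_ne] <;>
        · simp at h'; grind
    have e2 : π g b = c := by
      rw [hg, Perm.mul_apply, swap_apply_left, swap_apply_of_ne_of_ne] <;>
        · simp at h'; grind
    have e3 : π g c = b := by
      rw [hg, Perm.mul_apply, swap_apply_right, swap_apply_of_ne_of_ne] <;>
        · simp at h'; grind
    rw [e1, e2, e3, ← inv_eq h] at e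
    have hc : π (t a b c ^ 3) = 1 := by
      rw [map_pow, map_eq h, threeCyc_pow_three h]
    have e4 : (t a b c)⁻¹ ^ 3 = t a b c ^ 3 := by
      rw [← e, conj_pow, ((hπ.commute_of_map_eq_one hc g).eq).symm]; group
    calc t a b c ^ 6 = t a b c ^ 3 * t a b c ^ 3 := by group
      _ = t a b c ^ 3 * (t a b c)⁻¹ ^ 3 := by rw [e4]
      _ = 1 := by group
  refine ⟨fun a b c => t a b c ^ 4, ⟨?_, ?_, ?_, ?_, ?_⟩⟩
  · intro a b c h
    rw [map_pow, map_eq h, pow_succ, threeCyc_pow_three h, one_mul]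
  · intro g a b c h
    rw [← conj_pow, conj_eq g h]
  · intro a b c h
    rw [← inv_pow, inv_eq h]
  · intro a b c h
    rw [rotate h]
  · intro a b c h
    rw [← pow_mul, show 4 * 3 = 6 * 2 by norm_num, pow_mul, pow_six h, one_pow]

end IsAltCover

section
variable {α : Type*} [DecidableEq α]

theorem swap_mul_swap_mul_self {a b c d : α} (h : [a, b, c, d].Nodup) :
    (swap a b * swap c d) * (swap a b * swap c d) = 1 := by
  ext x
  simp only [Perm.mul_apply, swap_apply_def, Perm.one_apply]
  simp at h
  grind

theorem conj_swap_mul_swap (σ : Perm α) (a b c d : α) :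
    σ * (swap a b * swap c d) * σ⁻¹ = swap (σ a) (σ b) * swap (σ c) (σ d) := by
  rw [swap_apply_apply, swap_apply_apply]
  group

theorem sign_swap_mul_swap [Fintype α] {a b c d : α} (h : [a, b, c, d].Nodup) :
    sign (swap a b * swap c d) = 1 := by
  simp at h
  rw [Perm.sign_mul, sign_swap (by grind), sign_swap (by grind), Int.units_mul_self]

end

namespace IsAltCover

/-- Lifts of the elements of a Klein four-group acting on four points commute. -/
def LiftsCommute {G α : Type*} [Group G] [DecidableEq α] (π : G →* Perm α) : Prop :=
  ∀ ⦃a b c d : α⦄, [a, b, c, d].Nodup → ∀ ⦃g h : G⦄, π g = swap a b * swap c d →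
    π h = swap a c * swap b d → Commute g h

variable {G α : Type*} [Group G] [Fintype α] [DecidableEq α] {π : G →* Perm α}

namespace IsThreeCycSection
variable {s : α → α → α → G}

omit [Fintype α] in
theorem swap_fst (hs : IsThreeCycSection π s) {a b c : α} (h : [a, b, c].Nodup) :
    s b a c = (s a b c)⁻¹ := by
  rw [hs.inv_eq h, hs.rotate (a := b) (b := a) (c := c) (by simp at h ⊢; grind)]

theorem mul_eq (hs : IsThreeCycSection π s) (hπ : IsAltCover π) (hV : LiftsCommute π)
    {a b c d : α} (h : [a, b, c, d].Nodup) : s a b c * s b a d = s a d c := by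
  have habc : [a, b, c].Nodup := by simp at h ⊢; grind
  obtain ⟨v₁, hv₁⟩ := hπ.exists_map_eq _ (sign_swap_mul_swap h)
  obtain ⟨x, hx⟩ : ∃ x, x = s a b c := ⟨_, rfl⟩
  obtain ⟨v₂, hv₂⟩ : ∃ v, v = x * v₁ * x⁻¹ := ⟨_, rfl⟩
  obtain ⟨v₃, hv₃⟩ : ∃ v, v = x * v₂ * x⁻¹ := ⟨_, rfl⟩
  have hπx : π x = threeCyc a b c := hx ▸ hs.map_eq habc
  have xa : π x a = b := by rw [hπx, threeCyc_apply_fst habc]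
  have xb : π x b = c := by rw [hπx, threeCyc_apply_snd habc]
  have xc : π x c = a := by rw [hπx, threeCyc_apply_thd]
  have xd : π x d = d := by
    rw [hπx, threeCyc_apply_of_ne] <;> · simp at h; grind
  have hπ₂ : π v₂ = swap b c * swap a d := by
    rw [hv₂, map_mul, map_mul, map_inv, hv₁, conj_swap_mul_swap, xa, xb, xc, xd]
  have hπ₃ : π v₃ = swap c a * swap b d := by
    rw [hv₃, map_mul, map_mul, map_inv, hπ₂, conj_swap_mul_swap, xa, xb, xc, xd]
  have x3 : x * x * x = 1 := by
    rw [← hs.pow_three habc, hx, _root_.pow_three, mul_assoc]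
  have hxx : x * x = x⁻¹ := eq_inv_of_mul_eq_one_left x3
  have hv₁' : x * v₃ * x⁻¹ = v₁ := by
    calc x * v₃ * x⁻¹ = (x * x * x) * v₁ * (x * x * x)⁻¹ := by rw [hv₃, hv₂]; group
      _ = v₁ := by rw [x3]; group
  have hcomm : Commute v₂ v₃ := by
    refine hV (a := c) (b := b) (c := a) (d := d) (by simp at h ⊢; grind) ?_ hπ₃
    rw [hπ₂, swap_comm]
  have hsq : v₃ * v₃ = v₂ * v₂ := by
    have hz : π (v₂ * v₂) = 1 := by
      rw [map_mul, hπ₂, swap_mul_swap_mul_self (by simp at h ⊢; grind)]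
    calc v₃ * v₃ = x * (v₂ * v₂) * x⁻¹ := by rw [hv₃]; group
      _ = v₂ * v₂ := by rw [← (hπ.commute_of_map_eq_one hz x).eq]; group
  have hinv : v₂ * v₃⁻¹ = v₃ * v₂⁻¹ := by
    rw [mul_inv_eq_iff_eq_mul, mul_assoc, hcomm.inv_left.eq, ← mul_assoc, hsq, mul_assoc,
      mul_inv_cancel, mul_one]
  have e1 : s b a d = v₁ * x * v₁⁻¹ := by
    rw [hx, hs.conj_eq _ habc, hv₁]
    simp at h
    congr 1 <;> · simp only [Perm.mul_apply, swap_apply_def]; grind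
  have e2 : s a d c = v₃ * x⁻¹ * v₃⁻¹ := by
    have hacb : [a, c, b].Nodup := by simp at h ⊢; grind
    rw [hx, hs.inv_eq habc, hs.conj_eq _ hacb, hπ₃]
    have : [c, a, d].Nodup := by simp at h ⊢; grind
    rw [hs.rotate this]
    simp at h
    congr 1 <;> · simp only [Perm.mul_apply, swap_apply_def]; grind
  rw [e1, e2, ← hx]
  calc x * (v₁ * x * v₁⁻¹) = (x * v₁ * x⁻¹) * (x * x) * (v₁⁻¹) := by group
    _ = v₂ * x⁻¹ * v₁⁻¹ := by rw [← hv₂, hxx]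
    _ = v₂ * v₃⁻¹ * x⁻¹ := by rw [← hv₁']; group
    _ = v₃ * v₂⁻¹ * x⁻¹ := by rw [hinv]
    _ = v₃ * x⁻¹ * v₃⁻¹ := by nth_rewrite 3 [hv₃]; group

/-- The subgroup generated by the lifts of the three-cycles supported in a set. -/
def closure (s : α → α → α → G) (X : Set α) : Subgroup G :=
  Subgroup.closure {g | ∃ a b c, [a, b, c].Nodup ∧ a ∈ X ∧ b ∈ X ∧ c ∈ X ∧ g = s a b c}

omit [Fintype α] [DecidableEq α] in
theorem mem_closure {X : Set α} {a b c : α} (h : [a, b, c].Nodup) (ha : a ∈ X) (hb : b ∈ X)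
    (hc : c ∈ X) : s a b c ∈ closure s X :=
  Subgroup.subset_closure ⟨a, b, c, h, ha, hb, hc, rfl⟩

omit [Fintype α] in
theorem map_apply_of_mem_closure (hs : IsThreeCycSection π s) {X : Set α} {m : α} (hm : m ∉ X)
    {g : G} (hg : g ∈ closure s X) : π g m = m := by
  induction hg using Subgroup.closure_induction with
  | mem x hx =>
    obtain ⟨a, b, c, h, ha, hb, hc, rfl⟩ := hx
    rw [hs.map_eq h, threeCyc_apply_of_ne] <;> · rintro rfl; contradiction
  | one => simp
  | mul x y _ _ hx hy => rw [map_mul, Perm.mul_apply, hy, hx]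
  | inv x _ hx => rw [map_inv, Perm.inv_eq_iff_eq, hx]

/-- Coset representatives when one point is added to the support. -/
theorem exists_eq_mul_of_mem_closure_insert (hs : IsThreeCycSection π s) (hπ : IsAltCover π)
    (hV : LiftsCommute π) {X : Set α} {m : α} (hm : m ∉ X) {g : G}
    (hg : g ∈ closure s (insert m X)) :
    g ∈ closure s X ∨ ∃ j c, [m, j, c].Nodup ∧ j ∈ X ∧ c ∈ X ∧
      ∃ h ∈ closure s X, g = s m j c * h := by
  set P : G → Prop := fun g => g ∈ closure s X ∨ ∃ j c, [m, j, c].Nodup ∧ j ∈ X ∧ c ∈ X ∧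
      ∃ h ∈ closure s X, g = s m j c * h with hP
  change P g
  have key : ∀ {j c k}, [m, j, c].Nodup → [m, j, k].Nodup → j ∈ X → c ∈ X → k ∈ X →
      ∃ h ∈ closure s X, s m j k = s m j c * h := by
    intro j c k h1 h2 hj hc hk
    by_cases hck : c = k
    · subst hck
      exact ⟨1, one_mem _, by simp⟩
    · have h4 : [j, m, c, k].Nodup := by simp at h1 h2 ⊢; grind
      refine ⟨s j k c, mem_closure (by simp at h4 ⊢; grind) hj hk hc, ?_⟩
      rw [← hs.mul_eq hπ hV h4, hs.swap_fst (a := j) (b := m) (c := c) (by simp at h4 ⊢; grind),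
        inv_mul_cancel_left]
  have main : ∀ {j k b c : α} {h : G}, [m, j, k].Nodup → j ∈ X → k ∈ X → h ∈ closure s X →
      [j, b, c].Nodup → b ∈ insert m X → c ∈ insert m X → P (s j b c * (s m j k * h)) := by
    intro j k b c h hn hj hk hh hn' hb hc
    by_cases hbm : b = m
    · subst hbm
      have hcX : c ∈ X := hc.resolve_left (by simp at hn'; grind)
      have hn2 : [b, j, c].Nodup := by simp at hn' ⊢; grind
      obtain ⟨h', hh', e⟩ := key hn2 hn hj hcX hk
      left
      rw [e, hs.swap_fst hn2, mul_assoc, inv_mul_cancel_left]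
      exact mul_mem hh' hh
    by_cases hcm : c = m
    · subst hcm
      have hbX : b ∈ X := hb.resolve_left (by simp at hn'; grind)
      have hn2 : [c, j, b].Nodup := by simp at hn' ⊢; grind
      have hn3 : [c, b, j].Nodup := by simp at hn' ⊢; grind
      obtain ⟨h', hh', e⟩ := key hn2 hn hj hbX hk
      refine Or.inr ⟨b, j, hn3, hbX, hj, h' * h, mul_mem hh' hh, ?_⟩
      have := hs.pow_three hn2
      rw [_root_.pow_three] at this
      rw [e, hs.rotate hn2, ← hs.inv_eq hn2, eq_inv_mul_iff_mul_eq]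
      calc _ = (s c j b * (s c j b * s c j b)) * (h' * h) := by group
        _ = h' * h := by rw [this, one_mul]
    have hbX : b ∈ X := hb.resolve_left hbm
    have hcX : c ∈ X := hc.resolve_left hcm
    obtain ⟨h', hh', e⟩ := key (j := j) (c := c) (by simp at hn' ⊢; grind) hn hj hcX hk
    refine Or.inr ⟨b, c, by simp at hn' ⊢; grind, hbX, hcX, h' * h, mul_mem hh' hh, ?_⟩
    have e2 := hs.mul_eq hπ hV (a := c) (b := j) (c := b) (d := m) (by simp at hn' ⊢; grind)
    rw [hs.rotate (a := m) (b := j) (c := c) (by simp at hn' ⊢; grind),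
      ← hs.rotate (a := c) (b := j) (c := b) (by simp at hn' ⊢; grind),
      ← hs.rotate (a := c) (b := m) (c := b) (by simp at hn' ⊢; grind)] at e2
    rw [e, ← e2]
    group
  have step : ∀ {a b c : α}, [a, b, c].Nodup → a ∈ insert m X → b ∈ insert m X →
      c ∈ insert m X → ∀ y, P y → P (s a b c * y) := by
    rintro a b c hn ha hb hc y (hy | ⟨j, k, hn', hj, hk, h, hh, rfl⟩)
    · by_cases hma : a = m
      · subst hma
        exact Or.inr ⟨b, c, hn, hb.resolve_left (by simp at hn; grind),
          hc.resolve_left (by simp at hn; grind), y, hy, rfl⟩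
      by_cases hmb : b = m
      · subst hmb
        exact Or.inr ⟨c, a, by simp at hn ⊢; grind, hc.resolve_left (by simp at hn; grind),
          ha.resolve_left (by simp at hn; grind), y, hy, by rw [hs.rotate hn]⟩
      by_cases hmc : c = m
      · subst hmc
        refine Or.inr ⟨a, b, by simp at hn ⊢; grind, ha.resolve_left hma, hb.resolve_left hmb,
          y, hy, ?_⟩
        rw [← hs.rotate (a := c) (b := a) (c := b) (by simp at hn ⊢; grind)]
      exact Or.inl (mul_mem (mem_closure hn (ha.resolve_left hma) (hb.resolve_left hmb)
        (hc.resolve_left hmc)) hy)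
    · by_cases hjm : j ∈ [a, b, c]
      · simp only [List.mem_cons, List.not_mem_nil, or_false] at hjm
        rcases hjm with rfl | rfl | rfl
        · exact main hn' hj hk hh hn hb hc
        · rw [← hs.rotate hn]
          exact main hn' hj hk hh (by simp at hn ⊢; grind) hc ha
        · rw [hs.rotate (a := j) (b := a) (c := b) (by simp at hn ⊢; grind)]
          exact main hn' hj hk hh (by simp at hn ⊢; grind) ha hb
      · refine Or.inr ⟨j, k, hn', hj, hk, (s m j k)⁻¹ * s a b c * s m j k * h, ?_, by group⟩
        refine mul_mem ?_ hh
        have himg : ∀ x ∈ insert m X, x ≠ j → π (s m j k)⁻¹ x ∈ X := by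
          intro x hx hxj
          rw [hs.inv_eq hn', hs.map_eq (by simp at hn' ⊢; grind)]
          by_cases hxm : x = m
          · rwa [hxm, threeCyc_apply_fst (by simp at hn' ⊢; grind)]
          by_cases hxk : x = k
          · rwa [hxk, threeCyc_apply_snd (by simp at hn' ⊢; grind)]
          rw [threeCyc_apply_of_ne hxm hxk hxj]
          exact hx.resolve_left hxm
        have := hs.conj_eq (s m j k)⁻¹ hn
        rw [inv_inv] at this
        rw [this]
        simp only [List.mem_cons, List.not_mem_nil, or_false, not_or] at hjm
        exact mem_closure (hn.map (π (s m j k)⁻¹).injective) (himg _ ha (Ne.symm hjm.1))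
          (himg _ hb (Ne.symm hjm.2.1)) (himg _ hc (Ne.symm hjm.2.2))
  induction hg using Subgroup.closure_induction_left with
  | one => exact Or.inl (one_mem _)
  | mul_left x hx y _ hy =>
    obtain ⟨a, b, c, h, ha, hb, hc, rfl⟩ := hx
    exact step h ha hb hc y hy
  | inv_mul_cancel x hx y _ hy =>
    obtain ⟨a, b, c, h, ha, hb, hc, rfl⟩ := hx
    rw [hs.inv_eq h]
    exact step (by simp at h ⊢; grind) ha hc hb y hy

end IsThreeCycSection
end IsAltCover

section
variable {α : Type*} [DecidableEq α]

theorem commutator_threeCyc_of_common {p q r t : α} (h : [p, q, r, t].Nodup) :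
    ⁅threeCyc p q r, threeCyc p q t⁆ = swap p q * swap r t := by
  have h1 : [p, q, r].Nodup := by simp at h ⊢; grind
  have h2 : [p, q, t].Nodup := by simp at h ⊢; grind
  rw [commutatorElement_def, conj_threeCyc, threeCyc_inv h2, threeCyc_apply_fst h1,
    threeCyc_apply_snd h1, threeCyc_apply_of_ne]
  · ext x
    simp only [threeCyc, Perm.mul_apply, swap_apply_def]
    simp at h
    grind
  all_goals simp at h; grind

theorem swap_mul_swap_commute {a b c d : α} (h : [a, b, c, d].Nodup) :
    Commute (swap a b * swap c d) (swap a c * swap b d) := by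
  ext x
  simp only [Perm.mul_apply, swap_apply_def]
  simp at h
  grind

theorem Equiv.Perm.IsThreeCycle.exists_eq_threeCyc [Fintype α] {σ : Perm α}
    (hσ : IsThreeCycle σ) : ∃ a b c, [a, b, c].Nodup ∧ σ = threeCyc a b c := by
  have hc : 3 ≤ Fintype.card α := hσ.card_support ▸ Finset.card_le_univ _
  obtain ⟨a, -⟩ := exists_notMem_of_length_lt ([] : List α) (by simp; omega)
  obtain ⟨b, hb⟩ := exists_notMem_of_length_lt [a] (by simp; omega)
  obtain ⟨c, hc⟩ := exists_notMem_of_length_lt [a, b] (by simp; omega)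
  have h : [a, b, c].Nodup := by simp at hb hc ⊢; grind
  obtain ⟨τ, hτ⟩ := isConj_iff.1 (isConj_iff_cycleType_eq.2
    ((isThreeCycle_threeCyc h).cycleType.trans hσ.cycleType.symm))
  rw [conj_threeCyc] at hτ
  exact ⟨_, _, _, h.map τ.injective, hτ.symm⟩

/-- The alternating group is transitive on quadruples of distinct points. -/
theorem exists_sign_eq_one_apply_eq [Fintype α] (hα : 8 ≤ Fintype.card α) {a b c d a' b' c' d' : α}
    (h : [a, b, c, d].Nodup) (h' : [a', b', c', d'].Nodup) :
    ∃ σ : Perm α, sign σ = 1 ∧ σ a = a' ∧ σ b = b' ∧ σ c = c' ∧ σ d = d' := by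
  have : MulAction.IsMultiplyPretransitive (alternatingGroup α) α 4 := by
    have := alternatingGroup.isMultiplyPretransitive α
    refine MulAction.isMultiplyPretransitive_of_le (n := Nat.card α - 2) ?_ ?_
    · rw [Nat.card_eq_fintype_card]; omega
    · omega
  obtain ⟨σ, hσ⟩ := MulAction.exists_smul_eq (alternatingGroup α)
    (⟨[a, b, c, d].get, List.nodup_iff_injective_get.1 h⟩ : Fin 4 ↪ α)
    (⟨[a', b', c', d'].get, List.nodup_iff_injective_get.1 h'⟩ : Fin 4 ↪ α)
  have e := fun i => DFunLike.congr_fun hσ i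
  exact ⟨σ, σ.2, e 0, e 1, e 2, e 3⟩

end

namespace IsAltCover
variable {G α : Type*} [Group G] [Fintype α] [DecidableEq α] {π : G →* Perm α}

theorem IsThreeCycSection.eq_one_of_mem_closure {s : α → α → α → G} (hs : IsThreeCycSection π s)
    (hπ : IsAltCover π) (hV : LiftsCommute π) (X : Finset α) :
    ∀ g ∈ closure s (X : Set α), π g = 1 → g = 1 := by
  induction X using Finset.induction with
  | empty =>
    intro g hg _
    have : closure s ((∅ : Finset α) : Set α) = ⊥ := by
      rw [closure, Subgroup.closure_eq_bot_iff]
      rintro x ⟨a, b, c, -, ha, -⟩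
      simp at ha
    rwa [this, Subgroup.mem_bot] at hg
  | insert m X hm ih =>
    intro g hg hg1
    rw [Finset.coe_insert] at hg
    have hm' : m ∉ (X : Set α) := by simpa using hm
    obtain hg | ⟨j, c, hn, hj, hc, h, hh, rfl⟩ :=
      hs.exists_eq_mul_of_mem_closure_insert hπ hV hm' hg
    · exact ih g hg hg1
    · have := DFunLike.congr_fun hg1 m
      rw [map_mul, Perm.mul_apply, hs.map_apply_of_mem_closure hm' hh, hs.map_eq hn,
        threeCyc_apply_fst hn] at this
      simp at hn this
      grind

theorem eq_one_of_liftsCommute (hπ : IsAltCover π) (hα : 8 ≤ Fintype.card α)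
    (hG : commutator G = ⊤) (hV : LiftsCommute π) {g : G} (hg : π g = 1) : g = 1 := by
  obtain ⟨s, hs⟩ := hπ.exists_isThreeCycSection hα
  have hmap : ∀ x : G, ∃ h ∈ IsThreeCycSection.closure s (Set.univ : Set α), π h = π x := by
    intro x
    have hx : π x ∈ alternatingGroup α := hπ.sign_map x
    rw [← closure_three_cycles_eq_alternating] at hx
    have hle : Subgroup.closure {σ : Perm α | IsThreeCycle σ} ≤
        (IsThreeCycSection.closure s (Set.univ : Set α)).map π := by
      rw [Subgroup.closure_le]
      intro σ hσ
      obtain ⟨a, b, c, h, rfl⟩ := IsThreeCycle.exists_eq_threeCyc hσ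
      exact ⟨s a b c, IsThreeCycSection.mem_closure h trivial trivial trivial, hs.map_eq h⟩
    exact hle hx
  have htop : commutator G ≤ IsThreeCycSection.closure s (Set.univ : Set α) := by
    rw [commutator_def, Subgroup.commutator_le]
    intro x _ y _
    obtain ⟨x', hx', ex⟩ := hmap x
    obtain ⟨y', hy', ey⟩ := hmap y
    rw [← hπ.commutator_congr ex ey]
    exact mul_mem (mul_mem (mul_mem hx' hy') (inv_mem hx')) (inv_mem hy')
  refine hs.eq_one_of_mem_closure hπ hV Finset.univ g ?_ hg
  rw [Finset.coe_univ]
  exact htop (hG ▸ Subgroup.mem_top g)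

theorem commutator_lift_eq (hπ : IsAltCover π) (hα : 8 ≤ Fintype.card α)
    {a b c d a' b' c' d' : α} (h : [a, b, c, d].Nodup) (h' : [a', b', c', d'].Nodup)
    {v w v' w' : G} (hv : π v = swap a b * swap c d) (hw : π w = swap a c * swap b d)
    (hv' : π v' = swap a' b' * swap c' d') (hw' : π w' = swap a' c' * swap b' d') :
    ⁅v, w⁆ = ⁅v', w'⁆ := by
  obtain ⟨σ, hσ, ea, eb, ec, ed⟩ := exists_sign_eq_one_apply_eq hα h h'
  obtain ⟨g, rfl⟩ := hπ.exists_map_eq σ hσ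
  have h1 : π ⁅v, w⁆ = 1 := by
    rw [map_commutatorElement, hv, hw, commutatorElement_eq_one_iff_commute]
    exact swap_mul_swap_commute h
  calc ⁅v, w⁆ = g * ⁅v, w⁆ * g⁻¹ := by rw [← (hπ.commute_of_map_eq_one h1 g).eq]; group
    _ = ⁅g * v * g⁻¹, g * w * g⁻¹⁆ := by simp only [commutatorElement_def]; group
    _ = ⁅v', w'⁆ := by
      apply hπ.commutator_congr
      · rw [map_mul, map_mul, map_inv, hv, conj_swap_mul_swap, ea, eb, ec, ed, hv']
      · rw [map_mul, map_mul, map_inv, hw, conj_swap_mul_swap, ea, eb, ec, ed, hw']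

/-- The kernel of a perfect central extension of a large alternating group has at most one
non-trivial element, the commutator of lifts of generators of a Klein four-group. -/
theorem eq_one_or_eq_commutator (hπ : IsAltCover π) (hα : 8 ≤ Fintype.card α)
    (hG : commutator G = ⊤) {a b c d : α} (h : [a, b, c, d].Nodup) {v w : G}
    (hv : π v = swap a b * swap c d) (hw : π w = swap a c * swap b d) {ζ : G} (hζ : π ζ = 1) :
    ζ = 1 ∨ ζ = ⁅v, w⁆ := by
  have hz : π ⁅v, w⁆ = 1 := by
    rw [map_commutatorElement, hv, hw, commutatorElement_eq_one_iff_commute]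
    exact swap_mul_swap_commute h
  have hinv : ⁅v, w⁆⁻¹ = ⁅v, w⁆ := by
    rw [commutatorElement_inv]
    exact hπ.commutator_lift_eq hα (by simp at h ⊢; grind) h hw hv hv hw
  have hzle : Subgroup.zpowers ⁅v, w⁆ ≤ π.ker := by
    rw [Subgroup.zpowers_le]; exact hz
  have hN : (Subgroup.zpowers ⁅v, w⁆).Normal := by
    refine ⟨fun x hx g => ?_⟩
    rwa [← (hπ.commute_of_map_eq_one (hzle hx) g).eq, mul_assoc, mul_inv_cancel, mul_one]
  let ρ : G ⧸ Subgroup.zpowers ⁅v, w⁆ →* Perm α := QuotientGroup.lift _ π hzle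
  have hρ : IsAltCover ρ := by
    refine ⟨fun σ hσ => ?_, fun g => ?_, fun g hg => ?_⟩
    · obtain ⟨g, hg⟩ := hπ.exists_map_eq σ hσ
      exact ⟨g, hg⟩
    · obtain ⟨g, rfl⟩ := QuotientGroup.mk_surjective g
      exact hπ.sign_map g
    · obtain ⟨g, rfl⟩ := QuotientGroup.mk_surjective g
      rw [Subgroup.mem_center_iff]
      intro x
      obtain ⟨x, rfl⟩ := QuotientGroup.mk_surjective x
      exact congrArg _ (hπ.commute_of_map_eq_one hg x).eq.symm
  have hperf : commutator (G ⧸ Subgroup.zpowers ⁅v, w⁆) = ⊤ := by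
    have := Subgroup.map_commutator (⊤ : Subgroup G) ⊤ (QuotientGroup.mk' (Subgroup.zpowers ⁅v, w⁆))
    rw [← commutator_def, hG, Subgroup.map_top_of_surjective _ (QuotientGroup.mk'_surjective _)]
      at this
    rw [commutator_def, ← this]
  have hV : LiftsCommute ρ := by
    intro a' b' c' d' h' x y hx hy
    obtain ⟨x, rfl⟩ := QuotientGroup.mk_surjective x
    obtain ⟨y, rfl⟩ := QuotientGroup.mk_surjective y
    rw [← commutatorElement_eq_one_iff_commute]
    have := hπ.commutator_lift_eq hα h' h hx hy hv hw
    have e := (QuotientGroup.eq_one_iff (N := Subgroup.zpowers ⁅v, w⁆) ⁅x, y⁆).2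
      (this ▸ Subgroup.mem_zpowers _)
    rw [← e]
    rfl
  have := hρ.eq_one_of_liftsCommute hα hperf hV (g := (ζ : G ⧸ Subgroup.zpowers ⁅v, w⁆)) hζ
  rw [QuotientGroup.eq_one_iff, Subgroup.mem_zpowers_iff] at this
  obtain ⟨k, rfl⟩ := this
  have h2 : ⁅v, w⁆ ^ (2 : ℤ) = 1 := by
    rw [zpow_two]; nth_rewrite 1 [← hinv]; exact inv_mul_cancel _
  obtain ⟨m, rfl | rfl⟩ := Int.even_or_odd' k
  · left; rw [zpow_mul, h2, one_zpow]
  · right; rw [zpow_add, zpow_mul, h2, one_zpow, one_mul, zpow_one]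

/-- An element whose image has two transpositions in its cycle decomposition is conjugate to
all its translates by the kernel. -/
theorem exists_conj_eq_mul (hπ : IsAltCover π) (hα : 8 ≤ Fintype.card α)
    (hG : commutator G = ⊤) {a : G} {p q r t : α} (h : [p, q, r, t].Nodup)
    (hp : π a p = q) (hq : π a q = p) (hr : π a r = t) (ht : π a t = r) {ζ : G} (hζ : π ζ = 1) :
    ∃ g, g * a * g⁻¹ = a * ζ := by
  obtain ⟨k₁, hk₁⟩ := hπ.exists_map_eq (threeCyc p r q) (sign_threeCyc (by simp at h ⊢; grind))
  obtain ⟨k₂, hk₂⟩ := hπ.exists_map_eq (threeCyc p r t) (sign_threeCyc (by simp at h ⊢; grind))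
  have hk : π ⁅k₁, k₂⁆ = swap p r * swap q t := by
    rw [map_commutatorElement, hk₁, hk₂, commutator_threeCyc_of_common (by simp at h ⊢; grind)]
  obtain ⟨v, hv⟩ := hπ.exists_map_eq _ (sign_swap_mul_swap h)
  obtain ⟨u, rfl⟩ : ∃ u, a = v * u := ⟨v⁻¹ * a, by group⟩
  have hfix : ∀ x ∈ [p, q, r, t], π u x = x := by
    intro x hx
    apply (π v).injective
    rw [← Perm.mul_apply, ← map_mul, hv]
    simp only [List.mem_cons, List.not_mem_nil, or_false] at hx
    rcases hx with rfl | rfl | rfl | rfl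
    · rw [hp]; simp at h; simp only [Perm.mul_apply, swap_apply_def]; grind
    · rw [hq]; simp at h; simp only [Perm.mul_apply, swap_apply_def]; grind
    · rw [hr]; simp at h; simp only [Perm.mul_apply, swap_apply_def]; grind
    · rw [ht]; simp at h; simp only [Perm.mul_apply, swap_apply_def]; grind
  have huk : u * ⁅k₁, k₂⁆ * u⁻¹ = ⁅k₁, k₂⁆ := by
    calc _ = ⁅u * k₁ * u⁻¹, u * k₂ * u⁻¹⁆ := by simp only [commutatorElement_def]; group
      _ = _ := by
        apply hπ.commutator_congr
        · rw [map_mul, map_mul, map_inv, hk₁, conj_threeCyc, hfix p, hfix r, hfix q] <;> simp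
        · rw [map_mul, map_mul, map_inv, hk₂, conj_threeCyc, hfix p, hfix r, hfix t] <;> simp
  rcases hπ.eq_one_or_eq_commutator hα hG (by simp at h ⊢; grind) hk hv hζ with rfl | rfl
  · exact ⟨1, by simp⟩
  · refine ⟨⁅k₁, k₂⁆, ?_⟩
    rw [← (hπ.commute_of_map_eq_one hζ _).eq]
    generalize ⁅k₁, k₂⁆ = k at *
    calc k * (v * u) * k⁻¹ = k * v * u * k⁻¹ * (u⁻¹ * u) := by group
      _ = k * v * (u * k * u⁻¹)⁻¹ * u := by group
      _ = ⁅k, v⁆ * (v * u) := by rw [huk, commutatorElement_def]; group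

end IsAltCover

section ResiduallyP

theorem FreeGroup.exists_syllables {ι : Type*} (w : FreeGroup ι) :
    ∃ L : List (ι × ℤ), (∀ l ∈ L, l.2 ≠ 0) ∧ L.IsChain (fun l l' => l.1 ≠ l'.1) ∧
      w = (L.map fun l => FreeGroup.of l.1 ^ l.2).prod := by
  classical
  let W := Monoid.CoprodI.Word.equiv (freeGroupEquivCoprodI w)
  refine ⟨W.toList.map fun l => (l.1, FreeGroup.freeGroupUnitEquivInt l.2), ?_, ?_, ?_⟩
  · intro l hl
    obtain ⟨l', hl', rfl⟩ := List.mem_map.1 hl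
    intro h0
    apply W.ne_one l' hl'
    exact FreeGroup.freeGroupUnitEquivInt.injective (by
      simpa [FreeGroup.freeGroupUnitEquivInt] using h0)
  · rw [List.isChain_map]
    exact W.chain_ne
  · have hW : W.prod = freeGroupEquivCoprodI w := Monoid.CoprodI.Word.equiv.symm_apply_apply _
    rw [← freeGroupEquivCoprodI.symm_apply_apply w, ← hW, Monoid.CoprodI.Word.prod, map_list_prod,
      List.map_map, List.map_map]
    congr 1
    refine List.map_congr_left fun l _ => ?_
    have hl : l.2 = FreeGroup.of () ^ FreeGroup.freeGroupUnitEquivInt l.2 :=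
      (FreeGroup.freeGroupUnitEquivInt.symm_apply_apply l.2).symm
    simp only [Function.comp_apply]
    nth_rewrite 1 [hl]
    rw [map_zpow, map_zpow]
    congr 1

/-- In characteristic `p ^ m` a unipotent element has `p`-power order. -/
theorem exists_one_add_pow_prime_pow_eq_one {p : ℕ} (hp : p.Prime) (m r : ℕ) {A : Type*} [Ring A]
    [Algebra (ZMod (p ^ m)) A] {x : A} (hx : x ^ r = 0) : ∃ k, (1 + x) ^ p ^ k = 1 := by
  refine ⟨r + m, ?_⟩
  have hr : r ≤ p ^ r := (Nat.lt_pow_self hp.one_lt).le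
  obtain ⟨q, hq⟩ := exists_add_pow_prime_pow_eq hp (1 : Polynomial (ZMod (p ^ m))) Polynomial.X r
  have h1 : (p : Polynomial (ZMod (p ^ m))) ∣
      (1 + Polynomial.X) ^ p ^ r - (1 + Polynomial.X ^ p ^ r) := by
    rw [hq, one_pow]
    exact ⟨Polynomial.X * q, by ring⟩
  have h2 := dvd_sub_pow_of_dvd_sub h1 m
  have h3 : ((p : Polynomial (ZMod (p ^ m))) ^ (m + 1)) = 0 := by
    have : ((p ^ m : ℕ) : Polynomial (ZMod (p ^ m))) = 0 := by
      rw [← Polynomial.C_eq_natCast, ZMod.natCast_self, Polynomial.C_0]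
    rw [pow_succ, ← Nat.cast_pow, this, zero_mul]
  rw [h3, zero_dvd_iff, sub_eq_zero, ← pow_mul, ← pow_add] at h2
  have h4 := congrArg (Polynomial.aeval x) h2
  simp only [map_pow, map_add, map_one, Polynomial.aeval_X] at h4
  rw [h4, ← Nat.sub_add_cancel hr, pow_add, hx, mul_zero, add_zero, one_pow]

section Unitriangular
variable {R : Type*} [CommRing R] {n : ℕ}

theorem Matrix.mul_apply_eq_zero_of_lt {M N : Matrix (Fin n) (Fin n) R} {r t : ℕ}
    (hM : ∀ i j : Fin n, (j : ℕ) < i + r → M i j = 0)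
    (hN : ∀ i j : Fin n, (j : ℕ) < i + t → N i j = 0) (i j : Fin n) (hij : (j : ℕ) < i + (r + t)) :
    (M * N) i j = 0 := by
  rw [Matrix.mul_apply]
  refine Finset.sum_eq_zero fun l _ => ?_
  by_cases hl : (l : ℕ) < i + r
  · rw [hM i l hl, zero_mul]
  · rw [hN l j (by omega), mul_zero]

theorem Matrix.pow_eq_zero_of_strictUpper {M : Matrix (Fin n) (Fin n) R}
    (hM : ∀ i j : Fin n, (j : ℕ) < i + 1 → M i j = 0) : M ^ n = 0 := by
  have key : ∀ r, ∀ i j : Fin n, (j : ℕ) < i + r → (M ^ r) i j = 0 := by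
    intro r
    induction r with
    | zero =>
      intro i j h
      rw [pow_zero, Matrix.one_apply_ne]
      rintro rfl
      simp at h
    | succ r ih => exact Matrix.mul_apply_eq_zero_of_lt ih hM
  ext i j
  exact key n i j (by omega)

theorem exists_pow_prime_pow_eq_one_of_strictUpper {p m : ℕ} (hp : p.Prime)
    (u : (Matrix (Fin n) (Fin n) (ZMod (p ^ m)))ˣ)
    (hu : ∀ i j : Fin n, (j : ℕ) < i + 1 → (u.val - 1) i j = 0) :
    ∃ k, u ^ p ^ k = 1 := by
  obtain ⟨k, hk⟩ := exists_one_add_pow_prime_pow_eq_one hp m n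
    (Matrix.pow_eq_zero_of_strictUpper hu)
  exact ⟨k, Units.ext (by simpa using hk)⟩

/-- The group of unitriangular matrices over `ℤ/p^m`. -/
def unitriangular (p m n : ℕ) (hp : p.Prime) : Subgroup (Matrix (Fin n) (Fin n) (ZMod (p ^ m)))ˣ :=
  let S : Submonoid (Matrix (Fin n) (Fin n) (ZMod (p ^ m)))ˣ :=
    { carrier := {u | ∀ i j : Fin n, (j : ℕ) < i + 1 → (u.val - 1) i j = 0}
      one_mem' := by simp
      mul_mem' := by
        intro u v hu hv i j hij
        have : (u * v).val - 1 =
            (u.val - 1) * (v.val - 1) + (u.val - 1) +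
              (v.val - 1) := by
          rw [Units.val_mul]; noncomm_ring
        rw [this, Matrix.add_apply, Matrix.add_apply, hu i j hij, hv i j hij,
          Matrix.mul_apply_eq_zero_of_lt hu hv i j (by omega), add_zero, add_zero] }
  { S with
    inv_mem' := by
      intro u hu
      obtain ⟨k, hk⟩ := exists_pow_prime_pow_eq_one_of_strictUpper hp u hu
      have : u⁻¹ = u ^ (p ^ k - 1) := by
        rw [inv_eq_iff_mul_eq_one, ← pow_succ', Nat.sub_add_cancel (pow_pos hp.pos k), hk]
      rw [this]
      exact S.pow_mem hu _ }

theorem isPGroup_unitriangular (p m n : ℕ) (hp : p.Prime) :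
    IsPGroup p (unitriangular p m n hp) := by
  rintro ⟨u, hu⟩
  obtain ⟨k, hk⟩ := exists_pow_prime_pow_eq_one_of_strictUpper hp u hu
  exact ⟨k, Subtype.ext hk⟩

variable {ι : Type*} [DecidableEq ι]

/-- The nilpotent matrix attached to the letter `i` of a word with list of syllables `L`: it
moves from position `a` to position `a + 1` if the syllable at `a` is a power of `i`. -/
def syllableMatrix (R : Type*) [CommRing R] (L : List (ι × ℤ)) (i : ι) :
    Matrix (Fin (L.length + 1)) (Fin (L.length + 1)) R :=
  Matrix.of fun a b => if (b : ℕ) = a + 1 ∧ (L[(a : ℕ)]?).map Prod.fst = some i then 1 else 0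

theorem syllableMatrix_mul_self {L : List (ι × ℤ)} (hL : L.IsChain fun l l' => l.1 ≠ l'.1)
    (i : ι) : syllableMatrix R L i * syllableMatrix R L i = 0 := by
  ext a b
  rw [Matrix.mul_apply, Matrix.zero_apply]
  refine Finset.sum_eq_zero fun c _ => ?_
  simp only [syllableMatrix, Matrix.of_apply]
  by_contra hne
  have h1 : (c : ℕ) = a + 1 ∧ (L[(a : ℕ)]?).map Prod.fst = some i := by
    by_contra h; exact hne (by rw [if_neg h, zero_mul])
  have h2 : (b : ℕ) = c + 1 ∧ (L[(c : ℕ)]?).map Prod.fst = some i := by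
    by_contra h; exact hne (by rw [if_neg h, mul_zero])
  have hc : (a : ℕ) + 1 < L.length := by have := b.2; omega
  have := List.isChain_iff_getElem.1 hL a hc
  rw [h1.1] at h2
  simp [List.getElem?_eq_getElem hc, List.getElem?_eq_getElem (Nat.lt_of_succ_lt hc)] at h1 h2
  exact this (h1.2.trans h2.2.symm)

/-- The unipotent matrix attached to a letter of a word. -/
def syllableUnit {L : List (ι × ℤ)} (hL : L.IsChain fun l l' => l.1 ≠ l'.1) (i : ι) :
    (Matrix (Fin (L.length + 1)) (Fin (L.length + 1)) R)ˣ where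
  val := 1 + syllableMatrix R L i
  inv := 1 - syllableMatrix R L i
  val_inv := by
    rw [add_mul, mul_sub, mul_sub, syllableMatrix_mul_self hL]; simp
  inv_val := by
    rw [sub_mul, mul_add, mul_add, syllableMatrix_mul_self hL]; simp

theorem val_syllableUnit_zpow {L : List (ι × ℤ)} (hL : L.IsChain fun l l' => l.1 ≠ l'.1) (i : ι)
    (e : ℤ) : ((syllableUnit hL i ^ e : (Matrix (Fin (L.length + 1)) (Fin (L.length + 1)) R)ˣ) :
      Matrix (Fin (L.length + 1)) (Fin (L.length + 1)) R) = 1 + e • syllableMatrix R L i := by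
  induction e using Int.induction_on with
  | zero => simp
  | succ e ih =>
    rw [zpow_add_one, Units.val_mul, ih, syllableUnit, add_mul, mul_add, mul_add, smul_mul_assoc,
      smul_mul_assoc, syllableMatrix_mul_self hL, add_smul]
    simp only [one_mul, mul_one, smul_zero, add_zero, one_smul]
    abel
  | pred e ih =>
    rw [zpow_sub_one, Units.val_mul, ih]
    change _ * (1 - syllableMatrix R L i) = _
    rw [add_mul, mul_sub, mul_sub, smul_mul_assoc,
      smul_mul_assoc, syllableMatrix_mul_self hL, sub_smul]
    simp only [one_mul, mul_one, smul_zero, sub_zero, one_smul]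
    abel

theorem prod_syllableUnit_apply {L : List (ι × ℤ)} (hL : L.IsChain fun l l' => l.1 ≠ l'.1)
    (t : ℕ) (ht : t ≤ L.length) :
    (((L.take t).map fun l => syllableUnit (R := R) hL l.1 ^ l.2).prod.val 0
        ⟨t, Nat.lt_succ_of_le ht⟩ = (((L.take t).map Prod.snd).prod : ℤ)) ∧
    ∀ j : Fin (L.length + 1), t < (j : ℕ) →
      ((L.take t).map fun l => syllableUnit (R := R) hL l.1 ^ l.2).prod.val 0 j = 0 := by
  induction t with
  | zero =>
    refine ⟨by simp, fun j hj => ?_⟩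
    simp only [List.take_zero, List.map_nil, List.prod_nil, Units.val_one]
    rw [Matrix.one_apply_ne]
    rintro rfl
    simp at hj
  | succ t ih =>
    obtain ⟨ih1, ih2⟩ := ih (by omega)
    have htl : t < L.length := ht
    rw [List.take_succ_eq_append_getElem htl, List.map_append, List.prod_append, List.map_append,
      List.prod_append]
    simp only [List.map_cons, List.map_nil, List.prod_cons, List.prod_nil, mul_one, Units.val_mul,
      val_syllableUnit_zpow]
    generalize ((L.take t).map fun l => syllableUnit (R := R) hL l.1 ^ l.2).prod.val = M
      at ih1 ih2 ⊢
    simp only [mul_add, mul_one, Matrix.add_apply, mul_smul_comm, Matrix.smul_apply]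
    have hsum : ∀ j : Fin (L.length + 1), t + 1 ≤ j →
        (M * syllableMatrix R L L[t].1) 0 j = if t + 1 = (j : ℕ) then M 0 ⟨t, by omega⟩ else 0 := by
      intro j hj
      rw [Matrix.mul_apply, Finset.sum_eq_single (⟨(j : ℕ) - 1, by omega⟩ : Fin (L.length + 1))]
      · split_ifs with h
        · have : (⟨(j : ℕ) - 1, by omega⟩ : Fin (L.length + 1)) = ⟨t, by omega⟩ :=
            Fin.ext (by simp; omega)
          rw [this]
          simp [syllableMatrix, htl, h]
        · rw [ih2 _ (by simp; omega), zero_mul]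
      · intro b _ hb
        rw [syllableMatrix, Matrix.of_apply, if_neg, mul_zero]
        rintro ⟨h, -⟩
        exact hb (Fin.ext (by simp; omega))
      · simp
    refine ⟨?_, fun j hj => ?_⟩
    · rw [hsum _ le_rfl, ih2 _ (by simp), if_pos rfl, ih1]
      push_cast
      rw [zsmul_eq_mul, zero_add, mul_comm]
    · rw [hsum _ (by omega), ih2 _ (by omega), if_neg (by omega), smul_zero, add_zero]

end Unitriangular

theorem FreeGroup.exists_isPGroup_lift_ne_one {d : ℕ} {w : FreeGroup (Fin d)} (hw : w ≠ 1) {p : ℕ}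
    (hp : p.Prime) : ∃ (P : Type) (_ : Group P) (_ : Finite P) (f : Fin d → P), IsPGroup p P ∧
      FreeGroup.lift f w ≠ 1 := by
  obtain ⟨L, h0, hL, rfl⟩ := w.exists_syllables
  set N : ℤ := (L.map Prod.snd).prod with hN
  have hN0 : N ≠ 0 := by
    rw [hN]
    refine List.prod_ne_zero fun h => ?_
    obtain ⟨l, hl, e⟩ := List.mem_map.1 h
    exact h0 l hl e
  obtain ⟨m, hm⟩ : ∃ m, N.natAbs < p ^ m := ⟨_, Nat.lt_pow_self hp.one_lt⟩
  have hpm : NeZero (p ^ m) := ⟨(pow_pos hp.pos m).ne'⟩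
  have hlen : 0 < L.length := by
    rw [List.length_pos_iff]
    rintro rfl
    simp at hw
  let u : Fin d → (Matrix (Fin (L.length + 1)) (Fin (L.length + 1)) (ZMod (p ^ m)))ˣ :=
    syllableUnit hL
  have hu : ∀ i, u i ∈ unitriangular p m (L.length + 1) hp := by
    intro i a b hab
    have : (u i).val - 1 = syllableMatrix (ZMod (p ^ m)) L i := add_sub_cancel_left _ _
    rw [this, syllableMatrix, Matrix.of_apply, if_neg (by omega)]
  refine ⟨unitriangular p m (L.length + 1) hp, inferInstance, inferInstance, fun i => ⟨u i, hu i⟩,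
    isPGroup_unitriangular _ _ _ _, fun h => ?_⟩
  have h' := congrArg (fun x => ((unitriangular p m (L.length + 1) hp).subtype x).val 0
    ⟨L.length, Nat.lt_succ_self _⟩) h
  simp only [map_list_prod, List.map_map, Function.comp_def, map_zpow, FreeGroup.lift_apply_of,
    Subgroup.subtype_apply] at h'
  change _ = (1 : Matrix _ _ _) _ _ at h'
  have key := (prod_syllableUnit_apply (R := ZMod (p ^ m)) hL L.length le_rfl).1
  rw [List.take_length] at key
  rw [key, Matrix.one_apply_ne (by intro e; have := congrArg Fin.val e; simp at this; omega),
    ZMod.intCast_zmod_eq_zero_iff_dvd] at h'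
  have := Int.natAbs_dvd_natAbs.2 h'
  rw [Int.natAbs_natCast] at this
  exact absurd (Nat.le_of_dvd (Int.natAbs_pos.2 hN0) this) (by omega)

/-- A non-trivial word takes a value of order exactly `p` in some finite `p`-group. -/
theorem FreeGroup.exists_isPGroup_orderOf_lift_eq {d : ℕ} {w : FreeGroup (Fin d)} (hw : w ≠ 1)
    {p : ℕ} (hp : p.Prime) : ∃ (P : Type) (_ : Group P) (_ : Finite P) (f : Fin d → P),
      IsPGroup p P ∧ orderOf (FreeGroup.lift f w) = p := by
  have : Fact p.Prime := ⟨hp⟩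
  obtain ⟨P, _, _, f, hP, hf⟩ := FreeGroup.exists_isPGroup_lift_ne_one hw hp
  induction hn : Nat.card P using Nat.strong_induction_on generalizing P with
  | _ n ih =>
    have hnt : Nontrivial P := ⟨_, _, hf⟩
    have hc := hP.center_nontrivial
    have hdvd : p ∣ Nat.card (Subgroup.center P) := by
      obtain ⟨k, hk, e⟩ := (hP.to_subgroup (Subgroup.center P)).nontrivial_iff_card.1 hc
      exact e ▸ dvd_pow_self p hk.ne'
    obtain ⟨z, hz⟩ := exists_prime_orderOf_dvd_card' p hdvd
    have hz' : orderOf (z : P) = p := by rw [Subgroup.orderOf_coe, hz]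
    have hN : (Subgroup.zpowers (z : P)).Normal := by
      refine ⟨fun x hx g => ?_⟩
      have : x ∈ Subgroup.center P := (Subgroup.zpowers_le.2 z.2) hx
      rwa [Subgroup.mem_center_iff.1 this g, mul_assoc, mul_inv_cancel, mul_one]
    by_cases h1 : FreeGroup.lift f w ∈ Subgroup.zpowers (z : P)
    · refine ⟨P, _, ‹_›, f, hP, ?_⟩
      have h2 := orderOf_dvd_of_mem_zpowers h1
      rw [hz'] at h2
      exact ((Nat.dvd_prime hp).1 h2).resolve_left (by rwa [orderOf_eq_one_iff])
    · have hcomp : FreeGroup.lift (fun i => (f i : P ⧸ Subgroup.zpowers (z : P))) w =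
          (FreeGroup.lift f w : P ⧸ Subgroup.zpowers (z : P)) := by
        have : FreeGroup.lift (fun i => (f i : P ⧸ Subgroup.zpowers (z : P))) =
            (QuotientGroup.mk' _).comp (FreeGroup.lift f) := by ext i; simp
        rw [this]; rfl
      refine ih _ ?_ (P ⧸ Subgroup.zpowers (z : P)) inferInstance inferInstance
        (fun i => (f i : P ⧸ Subgroup.zpowers (z : P))) (hP.to_quotient _) ?_ rfl
      · have := Subgroup.card_eq_card_quotient_mul_card_subgroup (Subgroup.zpowers (z : P))
        rw [Nat.card_zpowers, hz', hn] at this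
        rw [this]
        exact lt_mul_of_one_lt_right Nat.card_pos hp.one_lt
      · rw [hcomp, Ne, QuotientGroup.eq_one_iff]
        exact h1

end ResiduallyP

section SumCongr
variable {α β : Type*} [Fintype α] [DecidableEq α] [Fintype β] [DecidableEq β]

theorem Equiv.Perm.cycleType_sumCongr (σ : Perm α) (τ : Perm β) :
    (Perm.sumCongr σ τ).cycleType = σ.cycleType + τ.cycleType := by
  have h1 : Perm.sumCongr σ (1 : Perm β) = σ.extendDomain (sumIsLeft (α := α) (β := β)).symm := by
    ext x
    rcases x with x | x
    · exact ((extendDomain_apply_image σ (sumIsLeft (α := α) (β := β)).symm x)).symm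
    · rw [extendDomain_apply_not_subtype _ _ (by simp)]
      rfl
  have h2 : Perm.sumCongr (1 : Perm α) τ = τ.extendDomain (sumIsRight (α := α) (β := β)).symm := by
    ext x
    rcases x with x | x
    · rw [extendDomain_apply_not_subtype _ _ (by simp)]
      rfl
    · exact ((extendDomain_apply_image τ (sumIsRight (α := α) (β := β)).symm x)).symm
  have hd : Disjoint (Perm.sumCongr σ (1 : Perm β)) (Perm.sumCongr (1 : Perm α) τ) := by
    rintro (x | x)
    · exact Or.inr rfl
    · exact Or.inl rfl
  rw [← cycleType_extendDomain (sumIsLeft (α := α) (β := β)).symm (g := σ),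
    ← cycleType_extendDomain (sumIsRight (α := α) (β := β)).symm (g := τ), ← h1, ← h2,
    ← hd.cycleType_mul, sumCongr_mul, one_mul, mul_one]

end SumCongr

section WordCycleType
variable {d : ℕ} {w : FreeGroup (Fin d)}

/-- `s` is the cycle type of a value of `w` on even permutations of `s.sum` points. -/
def IsWordCycleType (w : FreeGroup (Fin d)) (s : Multiset ℕ) : Prop :=
  ∃ (α : Type) (_ : Fintype α) (_ : DecidableEq α) (f : Fin d → Perm α),
    (∀ i, sign (f i) = 1) ∧ (FreeGroup.lift f w).cycleType = s ∧ Fintype.card α = s.sum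

theorem lift_sumCongr {α β : Type*} (f : Fin d → Perm α) (g : Fin d → Perm β) :
    FreeGroup.lift (fun i => Perm.sumCongr (f i) (g i)) w =
      Perm.sumCongr (FreeGroup.lift f w) (FreeGroup.lift g w) := by
  have : FreeGroup.lift (fun i => Perm.sumCongr (f i) (g i)) =
      (sumCongrHom α β).comp ((FreeGroup.lift f).prod (FreeGroup.lift g)) := by
    ext i : 1
    simp [sumCongrHom]
  rw [this]
  rfl

theorem IsWordCycleType.zero : IsWordCycleType w 0 :=
  ⟨Empty, inferInstance, inferInstance, fun _ => 1, fun _ => by simp, by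
    rw [Subsingleton.elim (FreeGroup.lift _ w) 1, cycleType_one], rfl⟩

theorem IsWordCycleType.add {s t : Multiset ℕ} (hs : IsWordCycleType w s)
    (ht : IsWordCycleType w t) : IsWordCycleType w (s + t) := by
  obtain ⟨α, _, _, f, hf, rfl, hα⟩ := hs
  obtain ⟨β, _, _, g, hg, rfl, hβ⟩ := ht
  refine ⟨α ⊕ β, inferInstance, inferInstance, fun i => Perm.sumCongr (f i) (g i),
    fun i => ?_, ?_, ?_⟩
  · rw [sign_sumCongr, hf, hg, one_mul]
  · rw [lift_sumCongr, cycleType_sumCongr]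
  · rw [Fintype.card_sum, hα, hβ, Multiset.sum_add]

theorem IsWordCycleType.nsmul {s : Multiset ℕ} (hs : IsWordCycleType w s) (n : ℕ) :
    IsWordCycleType w (n • s) := by
  induction n with
  | zero => rw [zero_smul]; exact .zero
  | succ n ih => rw [succ_nsmul]; exact ih.add hs

/-- The regular representation of a `p`-group in which `w` takes a value of order `p`. -/
theorem exists_cycleType_lift_eq_replicate (hw : w ≠ 1) {p : ℕ} (hp : p.Prime) :
    ∃ (α : Type) (_ : Fintype α) (_ : DecidableEq α) (f : Fin d → Perm α) (j : ℕ),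
      (∀ i, ∃ k, f i ^ p ^ k = 1) ∧
      (FreeGroup.lift f w).cycleType = Multiset.replicate (p ^ j) p ∧
      Fintype.card α = p ^ j * p := by
  classical
  have : Fact p.Prime := ⟨hp⟩
  obtain ⟨P, _, _, f, hP, hf⟩ := FreeGroup.exists_isPGroup_orderOf_lift_eq hw hp
  have := Fintype.ofFinite P
  have hlift : FreeGroup.lift (fun i => MulAction.toPermHom P P (f i)) w =
      MulAction.toPermHom P P (FreeGroup.lift f w) := by
    have : FreeGroup.lift (fun i => MulAction.toPermHom P P (f i)) =
        (MulAction.toPermHom P P).comp (FreeGroup.lift f) := by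
      ext i : 1
      simp
    rw [this]
    rfl
  have hord : orderOf (MulAction.toPermHom P P (FreeGroup.lift f w)) = p := by
    rw [orderOf_injective _ MulAction.toPerm_injective, hf]
  obtain ⟨n, hn⟩ := cycleType_prime_order (hord ▸ hp)
  rw [hord] at hn
  have hsupp : (MulAction.toPermHom P P (FreeGroup.lift f w)).support = Finset.univ := by
    ext x
    simp only [mem_support, Finset.mem_univ, iff_true, MulAction.toPermHom_apply,
      MulAction.toPerm_apply, smul_eq_mul, ne_eq, mul_eq_right]
    rw [← orderOf_eq_one_iff, hf]
    exact hp.one_lt.ne'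
  have hcard : Fintype.card P = (n + 1) * p := by
    rw [← Finset.card_univ, ← hsupp, ← sum_cycleType, hn]
    simp
    ring
  obtain ⟨k, hk⟩ := IsPGroup.iff_card.1 hP
  rw [Nat.card_eq_fintype_card, hcard] at hk
  obtain ⟨j, -, hj⟩ := (Nat.dvd_prime_pow hp).1 (hk ▸ Dvd.intro _ rfl : n + 1 ∣ p ^ k)
  refine ⟨P, inferInstance, inferInstance, fun i => MulAction.toPermHom P P (f i), j, fun i => ?_,
    ?_, ?_⟩
  · obtain ⟨k, hk⟩ := hP (f i)
    exact ⟨k, by rw [← map_pow, hk, map_one]⟩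
  · rw [hlift, hn, hj]
  · rw [hcard, hj]

theorem exists_isWordCycleType_two (hw : w ≠ 1) :
    ∃ j, IsWordCycleType w (Multiset.replicate (2 ^ (j + 1)) 2) := by
  obtain ⟨α, _, _, f, j, -, hw, hα⟩ := exists_cycleType_lift_eq_replicate hw Nat.prime_two
  refine ⟨j, α ⊕ α, inferInstance, inferInstance, fun i => Perm.sumCongr (f i) (f i), fun i => ?_,
    ?_, ?_⟩
  · rw [sign_sumCongr, Int.units_mul_self]
  · rw [lift_sumCongr, cycleType_sumCongr, hw, ← Multiset.replicate_add]
    ring_nf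
  · rw [Fintype.card_sum, hα]
    simp
    ring

theorem exists_isWordCycleType_three (hw : w ≠ 1) :
    ∃ j, IsWordCycleType w (Multiset.replicate (3 ^ j) 3) := by
  obtain ⟨α, _, _, f, j, hf, hw, hα⟩ := exists_cycleType_lift_eq_replicate hw Nat.prime_three
  refine ⟨j, α, inferInstance, inferInstance, f, fun i => ?_, hw, by simp [hα]⟩
  obtain ⟨k, hk⟩ := hf i
  have h3 : sign (f i) ^ 3 ^ k = 1 := by rw [← map_pow, hk, map_one]
  rwa [Int.units_pow_eq_pow_mod_two, Nat.pow_mod, show 3 % 2 = 1 from rfl, one_pow, Nat.one_mod,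
    pow_one] at h3

theorem IsWordCycleType.exists_lift_eq {s : Multiset ℕ} (hs : IsWordCycleType w s) {β : Type*}
    [Fintype β] [DecidableEq β] {x : Perm β} (hx : x.cycleType = s) :
    ∃ f : Fin d → Perm β, (∀ i, sign (f i) = 1) ∧ FreeGroup.lift f w = x := by
  obtain ⟨α, _, _, f, hf, hfs, hα⟩ := hs
  have e : α ≃ {b // b ∈ x.support} := Fintype.equivOfCardEq (by
    rw [hα, ← hx, sum_cycleType, Fintype.card_coe])
  have hlift : FreeGroup.lift (fun i => (f i).extendDomain e) w =
      (FreeGroup.lift f w).extendDomain e := by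
    have : FreeGroup.lift (fun i => (f i).extendDomain e) =
        (extendDomainHom e).comp (FreeGroup.lift f) := by
      ext i : 1
      simp [extendDomainHom]
    rw [this]
    rfl
  have hc : IsConj ((FreeGroup.lift f w).extendDomain e) x := by
    rw [isConj_iff_cycleType_eq, cycleType_extendDomain, hfs, hx]
  obtain ⟨c, hc⟩ := isConj_iff.1 hc
  refine ⟨fun i => c * (f i).extendDomain e * c⁻¹, fun i => ?_, ?_⟩
  · rw [map_mul, map_mul, sign_extendDomain, hf, map_inv, mul_one, mul_inv_cancel]
  · refine Eq.trans ?_ hc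
    rw [← hlift]
    have : FreeGroup.lift (fun i => c * (f i).extendDomain e * c⁻¹) =
        (MulAut.conj c).toMonoidHom.comp (FreeGroup.lift fun i => (f i).extendDomain e) := by
      ext i : 1
      simp
    rw [this]
    rfl

end WordCycleType

section Chain
variable {α : Type*} [DecidableEq α]

theorem disjoint_swap_of_apply_eq {x : Perm α} {a b : α} (ha : x a = a) (hb : x b = b) :
    Disjoint (swap a b) x := by
  intro z
  by_cases hz : z = a ∨ z = b
  · rcases hz with rfl | rfl
    · exact Or.inr ha
    · exact Or.inr hb
  · exact Or.inl (swap_apply_of_ne_of_ne (fun h => hz (Or.inl h)) fun h => hz (Or.inr h))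

theorem formPerm_cons_mul_swap {q r : α} {l : List α} (hr : r ∉ q :: l) (hq : q ∉ l) :
    (q :: l).formPerm * swap q r = (q :: r :: l).formPerm := by
  rw [List.mem_cons, not_or] at hr
  have h : swap q r * (r :: l).formPerm * swap q r = (q :: l).formPerm := by
    cases l with
    | nil => simp
    | cons b l =>
      rw [List.formPerm_cons_cons, List.formPerm_cons_cons]
      have hb : b ≠ q ∧ b ≠ r :=
        ⟨fun h => hq (h ▸ List.mem_cons_self), fun h => hr.2 (h ▸ List.mem_cons_self)⟩
      have hd : Disjoint (swap q r) (b :: l).formPerm :=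
        disjoint_swap_of_apply_eq (List.formPerm_apply_of_notMem hq)
          (List.formPerm_apply_of_notMem hr.2)
      have hs : swap q r * swap r b * swap q r = swap q b := by
        rw [swap_comm q r, swap_comm r b, swap_mul_swap_mul_swap hb.2 hb.1]
      rw [← hs]
      simp only [mul_assoc]
      rw [hd.commute.eq]
  rw [← h, mul_assoc, swap_mul_self, mul_one, List.formPerm_cons_cons]

variable [Fintype α]

/-- The cycle `l` is the product of `x`, with `a` two-cycles and `e` three-cycles, and of the
involution `y`, with `c` two-cycles. -/
structure IsCycleFactorization (l : List α) (x y : Perm α) (a e c : ℕ) : Prop where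
  nodup : l.Nodup
  mul_eq : x * y = l.formPerm
  left_apply : ∀ z ∉ l, x z = z
  right_apply : ∀ z ∉ l, y z = z
  left_type : x.cycleType = Multiset.replicate a 2 + Multiset.replicate e 3
  right_type : y.cycleType = Multiset.replicate c 2

namespace IsCycleFactorization
variable {l : List α} {x y : Perm α} {a e c : ℕ} {p q r s : α}

theorem rotate (h : IsCycleFactorization (q :: l) x y a e c) :
    IsCycleFactorization (l ++ [q]) x y a e c where
  nodup := (List.perm_append_singleton q l).nodup_iff.2 h.nodup
  mul_eq := by
    rw [h.mul_eq, ← List.formPerm_rotate_one _ h.nodup]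
    simp
  left_apply z hz := h.left_apply z fun hz' => hz ((List.perm_append_singleton q l).mem_iff.2 hz')
  right_apply z hz :=
    h.right_apply z fun hz' => hz ((List.perm_append_singleton q l).mem_iff.2 hz')
  left_type := h.left_type
  right_type := h.right_type

theorem mul_swap (h : IsCycleFactorization (q :: l) x y a e c) (hq : y q = q) (hr : r ∉ q :: l) :
    IsCycleFactorization (q :: r :: l) x (y * swap q r) a e (c + 1) where
  nodup := by
    have := h.nodup
    grind
  mul_eq := by
    rw [← mul_assoc, h.mul_eq, formPerm_cons_mul_swap hr (List.nodup_cons.1 h.nodup).1]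
  left_apply z hz := h.left_apply z (by grind)
  right_apply z hz := by
    rw [mul_apply, swap_apply_of_ne_of_ne (by grind) (by grind)]
    exact h.right_apply z (by grind)
  left_type := h.left_type
  right_type := by
    rw [← (disjoint_swap_of_apply_eq hq (h.right_apply r hr)).commute.eq,
      (disjoint_swap_of_apply_eq hq (h.right_apply r hr)).cycleType_mul, h.right_type,
      (isCycle_swap (by grind)).cycleType, card_support_swap (by grind),
      Multiset.replicate_succ, Multiset.singleton_add]

theorem mul_swap_second (h : IsCycleFactorization (p :: q :: l) x y a e c) (hq : y q = q)
    (hr : r ∉ p :: q :: l) :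
    IsCycleFactorization (p :: q :: r :: l) x (y * swap q r) a e (c + 1) := by
  have hp : (p :: q :: l).Nodup := h.nodup
  have h' := h.rotate
  rw [List.cons_append] at h'
  have h2 := h'.mul_swap (r := r) hq (by grind)
  refine ⟨by grind, ?_, fun z hz => h2.left_apply z (by grind), fun z hz =>
    h2.right_apply z (by grind), h2.left_type, h2.right_type⟩
  rw [h2.mul_eq, ← List.formPerm_rotate_one (p :: q :: r :: l) (by grind)]
  simp

theorem swap_mul (h : IsCycleFactorization (q :: l) x y a e c) (hq : x q = q) (hr : r ∉ q :: l) :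
    IsCycleFactorization (r :: q :: l) (swap r q * x) y (a + 1) e c where
  nodup := List.nodup_cons.2 ⟨hr, h.nodup⟩
  mul_eq := by rw [mul_assoc, h.mul_eq, List.formPerm_cons_cons]
  left_apply z hz := by
    rw [mul_apply, h.left_apply z (by grind), swap_apply_of_ne_of_ne (by grind) (by grind)]
  right_apply z hz := h.right_apply z (by grind)
  left_type := by
    rw [(disjoint_swap_of_apply_eq (h.left_apply r hr) hq).cycleType_mul, h.left_type,
      (isCycle_swap (by grind)).cycleType, card_support_swap (by grind),
      Multiset.replicate_succ, Multiset.singleton_add, Multiset.cons_add]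
  right_type := h.right_type

theorem swap_mul_swap_mul (h : IsCycleFactorization (q :: l) x y a e c) (hq : x q = q)
    (hr : r ∉ q :: l) (hs : s ∉ r :: q :: l) :
    IsCycleFactorization (s :: r :: q :: l) (swap r s * swap r q * x) y a (e + 1) c where
  nodup := List.nodup_cons.2 ⟨hs, List.nodup_cons.2 ⟨hr, h.nodup⟩⟩
  mul_eq := by
    rw [mul_assoc, mul_assoc, h.mul_eq, List.formPerm_cons_cons, List.formPerm_cons_cons,
      swap_comm r s]
  left_apply z hz := by
    rw [mul_apply, mul_apply, h.left_apply z (by grind),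
      swap_apply_of_ne_of_ne (by grind) (by grind), swap_apply_of_ne_of_ne (by grind) (by grind)]
  right_apply z hz := h.right_apply z (by grind)
  left_type := by
    have hr' := h.left_apply r hr
    have hs' := h.left_apply s (by grind)
    rw [((disjoint_swap_of_apply_eq hr' hs').mul_left
      (disjoint_swap_of_apply_eq hr' hq)).cycleType_mul, h.left_type,
      (isThreeCycle_swap_mul_swap_same (by grind) (by grind) (by grind)).cycleType,
      Multiset.replicate_succ, Multiset.singleton_add, Multiset.add_cons]
  right_type := h.right_type

end IsCycleFactorization

/-- Some cycle through `k` points is a product as in `IsCycleFactorization`, where the second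
factor fixes a point of the cycle. -/
def HasCycleFactorization (α : Type*) [DecidableEq α] [Fintype α] (k a e c : ℕ) : Prop :=
  ∃ (q : α) (l : List α) (x y : Perm α), IsCycleFactorization (q :: l) x y a e c ∧ y q = q ∧
    l.length + 1 = k

namespace HasCycleFactorization
variable {k a e c : ℕ}

theorem one (hk : 1 ≤ Fintype.card α) : HasCycleFactorization α 1 0 0 0 := by
  obtain ⟨q, -⟩ := exists_notMem_of_length_lt ([] : List α) hk
  exact ⟨q, [], 1, 1, ⟨by simp, by simp, by simp, by simp, by simp, by simp⟩, rfl, rfl⟩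

theorem two (hk : 2 ≤ Fintype.card α) : HasCycleFactorization α 2 1 0 0 := by
  obtain ⟨q, l, x, y, h, hq, hl⟩ := one (α := α) (by omega)
  obtain rfl : l = [] := List.eq_nil_of_length_eq_zero (by omega)
  obtain ⟨r, hr⟩ := exists_notMem_of_length_lt [q] hk
  refine ⟨r, [q], _, y, h.swap_mul ?_ hr, h.right_apply r hr, rfl⟩
  have := h.mul_eq
  rw [List.formPerm_singleton] at this
  conv_lhs => rw [← hq, ← mul_apply, this, one_apply]

theorem three (hk : 3 ≤ Fintype.card α) : HasCycleFactorization α 3 0 1 0 := by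
  obtain ⟨q, l, x, y, h, hq, hl⟩ := one (α := α) (by omega)
  obtain rfl : l = [] := List.eq_nil_of_length_eq_zero (by omega)
  obtain ⟨r, hr⟩ := exists_notMem_of_length_lt [q] (by simp; omega)
  obtain ⟨s, hs⟩ := exists_notMem_of_length_lt [r, q] (by simp; omega)
  refine ⟨s, [r, q], _, y, h.swap_mul_swap_mul ?_ hr hs, h.right_apply s (by grind), rfl⟩
  have := h.mul_eq
  rw [List.formPerm_singleton] at this
  conv_lhs => rw [← hq, ← mul_apply, this, one_apply]

/-- The new point `r` follows `q` in the cycle and is fixed by the first factor. -/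
theorem exists_mul_swap (h : HasCycleFactorization α k a e c) (hk : k < Fintype.card α) :
    ∃ (r : α) (l : List α) (x y : Perm α), IsCycleFactorization (r :: l) x y a e (c + 1) ∧
      x r = r ∧ l.length = k := by
  obtain ⟨q, l, x, y, h, hq, hl⟩ := h
  obtain ⟨r, hr⟩ := exists_notMem_of_length_lt (q :: l) (by simp; omega)
  exact ⟨r, l ++ [q], x, _, (h.mul_swap hq hr).rotate, h.left_apply r hr, by simp [hl]⟩

theorem add_two (h : HasCycleFactorization α k a e c) (hk : k + 2 ≤ Fintype.card α) :
    HasCycleFactorization α (k + 2) (a + 1) e (c + 1) := by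
  obtain ⟨r, l, x, y, h, hr, hl⟩ := h.exists_mul_swap (by omega)
  obtain ⟨s, hs⟩ := exists_notMem_of_length_lt (r :: l) (by simp; omega)
  exact ⟨s, r :: l, _, y, h.swap_mul hr hs, h.right_apply s hs, by simp [hl]⟩

theorem add_three (h : HasCycleFactorization α k a e c) (hk : k + 3 ≤ Fintype.card α) :
    HasCycleFactorization α (k + 3) a (e + 1) (c + 1) := by
  obtain ⟨r, l, x, y, h, hr, hl⟩ := h.exists_mul_swap (by omega)
  obtain ⟨s, hs⟩ := exists_notMem_of_length_lt (r :: l) (by simp; omega)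
  obtain ⟨t, ht⟩ := exists_notMem_of_length_lt (s :: r :: l) (by simp; omega)
  exact ⟨t, s :: r :: l, _, y, h.swap_mul_swap_mul hr hs ht, h.right_apply t (by grind),
    by simp [hl]⟩

theorem add_four (h : HasCycleFactorization α k a e c) (hk : k + 4 ≤ Fintype.card α) :
    HasCycleFactorization α (k + 4) a (e + 1) (c + 2) := by
  obtain ⟨r, l, x, y, h, hr, hl⟩ := h.exists_mul_swap (by omega)
  obtain ⟨s, hs⟩ := exists_notMem_of_length_lt (r :: l) (by simp; omega)
  obtain ⟨t, ht⟩ := exists_notMem_of_length_lt (s :: r :: l) (by simp; omega)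
  obtain ⟨u, hu⟩ := exists_notMem_of_length_lt (t :: s :: r :: l) (by simp; omega)
  refine ⟨t, s :: u :: r :: l, _, _, (h.swap_mul_swap_mul hr hs ht).mul_swap_second
    (h.right_apply s hs) hu, ?_, by simp [hl]⟩
  rw [mul_apply, swap_apply_of_ne_of_ne (by grind) (by grind)]
  exact h.right_apply t (by grind)

theorem iterate (h : HasCycleFactorization α k a e c) (i j t : ℕ)
    (hk : k + 3 * i + 4 * j + 2 * t ≤ Fintype.card α) :
    HasCycleFactorization α (k + 3 * i + 4 * j + 2 * t) (a + t) (e + i + j)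
      (c + i + 2 * j + t) := by
  have hi : HasCycleFactorization α (k + 3 * i) a (e + i) (c + i) := by
    replace hk : k + 3 * i ≤ Fintype.card α := by omega
    induction i with
    | zero => exact h
    | succ i ih => exact (ih (by omega)).add_three (by omega)
  have hj : HasCycleFactorization α (k + 3 * i + 4 * j) a (e + i + j) (c + i + 2 * j) := by
    replace hk : k + 3 * i + 4 * j ≤ Fintype.card α := by omega
    clear h
    induction j with
    | zero => exact hi
    | succ j ih => exact (ih (by omega)).add_four (by omega)
  clear h hi
  induction t with
  | zero => exact hj
  | succ t ih => exact (ih (by omega)).add_two (by omega)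

end HasCycleFactorization
end Chain

section Factorization

theorem parts_partition_sumCongr {α β : Type*} [Fintype α] [DecidableEq α] [Fintype β]
    [DecidableEq β] (σ : Perm α) (τ : Perm β) :
    (Perm.sumCongr σ τ).partition.parts = σ.partition.parts + τ.partition.parts := by
  have hσ := σ.sum_cycleType_le
  have hτ := τ.sum_cycleType_le
  have h : Fintype.card (α ⊕ β) - (σ.cycleType + τ.cycleType).sum =
      (Fintype.card α - σ.cycleType.sum) + (Fintype.card β - τ.cycleType.sum) := by
    rw [Fintype.card_sum, Multiset.sum_add]
    omega
  simp only [parts_partition, ← sum_cycleType, cycleType_sumCongr, h, Multiset.replicate_add]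
  abel

/-- A permutation with orbit sizes `m` is the product of a permutation with `a` two-cycles and `e`
three-cycles, and of one with `c` two-cycles. -/
def IsFactorType (m : Multiset ℕ) (a e c : ℕ) : Prop :=
  ∃ (α : Type) (_ : Fintype α) (_ : DecidableEq α) (x y : Perm α),
    (x * y).partition.parts = m ∧ x.cycleType = Multiset.replicate a 2 + Multiset.replicate e 3 ∧
      y.cycleType = Multiset.replicate c 2

namespace IsFactorType
variable {m m' : Multiset ℕ} {a e c a' e' c' : ℕ}

theorem zero : IsFactorType 0 0 0 0 :=
  ⟨Empty, inferInstance, inferInstance, 1, 1, by simp [parts_partition], by simp, by simp⟩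

theorem add (h : IsFactorType m a e c) (h' : IsFactorType m' a' e' c') :
    IsFactorType (m + m') (a + a') (e + e') (c + c') := by
  obtain ⟨α, _, _, x, y, rfl, hx, hy⟩ := h
  obtain ⟨β, _, _, x', y', rfl, hx', hy'⟩ := h'
  refine ⟨α ⊕ β, inferInstance, inferInstance, Perm.sumCongr x x', Perm.sumCongr y y', ?_, ?_, ?_⟩
  · rw [Perm.sumCongr_mul, parts_partition_sumCongr]
  · rw [cycleType_sumCongr, hx, hx', Multiset.replicate_add, Multiset.replicate_add]
    abel
  · rw [cycleType_sumCongr, hy, hy', Multiset.replicate_add]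

theorem nsmul (h : IsFactorType m a e c) (n : ℕ) :
    IsFactorType (n • m) (n * a) (n * e) (n * c) := by
  induction n with
  | zero => simpa using zero
  | succ n ih =>
    rw [succ_nsmul, Nat.succ_mul, Nat.succ_mul, Nat.succ_mul]
    exact ih.add h

theorem symm (h : IsFactorType m a 0 c) : IsFactorType m c 0 a := by
  obtain ⟨α, _, _, x, y, rfl, hx, hy⟩ := h
  refine ⟨α, inferInstance, inferInstance, y⁻¹, x⁻¹, ?_, by simpa using hy, by simpa using hx⟩
  rw [← mul_inv_rev, parts_partition, parts_partition, cycleType_inv, support_inv]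

theorem exists_mul_eq (h : IsFactorType m a e c) {β : Type*} [Fintype β] [DecidableEq β]
    {g : Perm β} (hg : g.partition.parts = m) :
    ∃ x y : Perm β, g = x * y ∧
      x.cycleType = Multiset.replicate a 2 + Multiset.replicate e 3 ∧
      y.cycleType = Multiset.replicate c 2 := by
  obtain ⟨α, _, _, x, y, hm, hx, hy⟩ := h
  have ε : α ≃ β := Fintype.equivOfCardEq (by
    rw [← (x * y).partition.parts_sum, ← g.partition.parts_sum, hm, hg])
  let ε' : α ≃ {b : β // True} := ε.trans (Equiv.subtypeUnivEquiv fun _ => trivial).symm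
  have hc : IsConj ((x * y).extendDomain ε') g := by
    rw [isConj_iff_cycleType_eq, cycleType_extendDomain, ← filter_parts_partition_eq_cycleType,
      ← filter_parts_partition_eq_cycleType, hm, hg]
  obtain ⟨t, ht⟩ := isConj_iff.1 hc
  refine ⟨t * x.extendDomain ε' * t⁻¹, t * y.extendDomain ε' * t⁻¹, ?_, ?_, ?_⟩
  · rw [← ht, ← extendDomain_mul]
    group
  · rw [cycleType_conj, cycleType_extendDomain, hx]
  · rw [cycleType_conj, cycleType_extendDomain, hy]

theorem sign_eq (h : IsFactorType m a e c) {β : Type*} [Fintype β] [DecidableEq β]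
    {g : Perm β} (hg : g.partition.parts = m) : sign g = (-1) ^ (a + c) := by
  obtain ⟨x, y, rfl, hx, hy⟩ := h.exists_mul_eq hg
  have h2 : ∀ n : ℕ, (-1 : ℤˣ) ^ (n * 2 + n) = (-1) ^ n := fun n => by
    rw [pow_add, mul_comm n 2, pow_mul]
    simp
  have h3 : ∀ n : ℕ, (-1 : ℤˣ) ^ (n * 3 + n) = 1 := fun n => by
    rw [show n * 3 + n = 2 * (2 * n) by ring, pow_mul]
    simp
  rw [map_mul, sign_of_cycleType, sign_of_cycleType, hx, hy, pow_add]
  simp only [Multiset.sum_add, Multiset.card_add, Multiset.sum_replicate, Multiset.card_replicate,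
    smul_eq_mul]
  rw [h2, ← pow_add _ (a * 2 + e * 3),
    show a * 2 + e * 3 + (a + e) = (a * 2 + a) + (e * 3 + e) by ring, pow_add, h2, h3, mul_one, pow_add]

end IsFactorType

theorem HasCycleFactorization.isFactorType {k a e c : ℕ}
    (h : HasCycleFactorization (Fin k) k a e c) : IsFactorType {k} a e c := by
  obtain ⟨q, l, x, y, h, -, hl⟩ := h
  refine ⟨Fin k, inferInstance, inferInstance, x, y, ?_, h.left_type, h.right_type⟩
  rw [parts_partition, h.mul_eq]
  rcases l with - | ⟨r, l⟩
  · obtain rfl : k = 1 := by simpa using hl.symm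
    simp
  · have hs : (q :: r :: l).formPerm.support.card = k := by
      rw [List.support_formPerm_of_nodup _ h.nodup (by simp), List.toFinset_card_of_nodup h.nodup]
      simpa using hl
    rw [(List.isCycle_formPerm h.nodup (by simp)).cycleType, hs, Fintype.card_fin]
    simp

theorem isFactorType_of_odd (i j t : ℕ) :
    IsFactorType {1 + 3 * i + 4 * j + 2 * t} t (i + j) (i + 2 * j + t) := by
  have := (HasCycleFactorization.one (α := Fin (1 + 3 * i + 4 * j + 2 * t))
    (by simp; omega)).iterate i j t (by simp)
  simpa using this.isFactorType

theorem isFactorType_of_even (i j t : ℕ) :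
    IsFactorType {2 + 3 * i + 4 * j + 2 * t} (t + 1) (i + j) (i + 2 * j + t) := by
  have := (HasCycleFactorization.two (α := Fin (2 + 3 * i + 4 * j + 2 * t))
    (by simp; omega)).iterate i j t (by simp)
  simpa [add_comm 1] using this.isFactorType

theorem isFactorType_of_three (t : ℕ) : IsFactorType {3 + 2 * t} t 1 t := by
  have := (HasCycleFactorization.three (α := Fin (3 + 2 * t)) (by simp)).iterate 0 0 t (by simp)
  simpa using this.isFactorType

/-- Any permutation is a product of two involutions with nearly as many two-cycles. -/
theorem exists_isFactorType (m : Multiset ℕ) (hm : ∀ k ∈ m, 0 < k) :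
    ∃ a, IsFactorType m a 0 a ∨ IsFactorType m (a + 1) 0 a := by
  induction m using Multiset.induction with
  | empty => exact ⟨0, Or.inl .zero⟩
  | cons k m ih =>
    rw [← Multiset.singleton_add]
    obtain ⟨b, hb⟩ := ih fun k hk => hm k (Multiset.mem_cons_of_mem hk)
    have hk : 0 < k := hm k (Multiset.mem_cons_self k m)
    obtain ⟨t, rfl | rfl⟩ : ∃ t, k = 1 + 2 * t ∨ k = 2 + 2 * t := by
      exact ⟨(k - 1) / 2, by omega⟩
    · have h : IsFactorType {1 + 2 * t} t 0 t := by simpa using isFactorType_of_odd 0 0 t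
      exact ⟨t + b, hb.imp (fun hb => h.add hb) fun hb => h.add hb⟩
    · have h : IsFactorType {2 + 2 * t} (t + 1) 0 t := by simpa using isFactorType_of_even 0 0 t
      rcases hb with hb | hb
      · refine ⟨t + b, Or.inr ?_⟩
        convert h.add hb using 1
        ring
      · refine ⟨t + 1 + b, Or.inl ?_⟩
        convert h.add hb.symm using 1
        ring

theorem exists_isFactorType_pair {k : ℕ} (hk : 0 < k) :
    ∃ c e e', IsFactorType {k, k} c e c ∧ IsFactorType {k, k} (c + 1) e' (c + 1) := by
  have hkk : ({k, k} : Multiset ℕ) = {k} + {k} := rfl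
  obtain ⟨t, rfl | rfl⟩ : ∃ t, k = 1 + 2 * t ∨ k = 2 + 2 * t := ⟨(k - 1) / 2, by omega⟩
  · have h : IsFactorType {1 + 2 * t} t 0 t := by simpa using isFactorType_of_odd 0 0 t
    rcases t with - | t
    · refine ⟨0, 0, 0, by simpa using h.add h, Bool, inferInstance, inferInstance,
        swap true false, swap true false, ?_, ?_, ?_⟩
      · simp [parts_partition]
      · simp [(isCycle_swap (show true ≠ false by decide)).cycleType]
      · simp [(isCycle_swap (show true ≠ false by decide)).cycleType]
    · have h3 := isFactorType_of_three t
      rw [show 3 + 2 * t = 1 + 2 * (t + 1) by ring] at h3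
      refine ⟨2 * t + 1, 1, 0, ?_, ?_⟩
      · rw [hkk]
        convert h.add h3 using 1 <;> ring
      · rw [hkk]
        convert h.add h using 1 <;> ring
  · have h : IsFactorType {2 + 2 * t} (t + 1) 0 t := by simpa using isFactorType_of_even 0 0 t
    rcases t with - | t
    · refine ⟨1, 0, 0, by simpa using h.add h.symm, Fin 4, inferInstance, inferInstance,
        swap 0 1 * swap 2 3, swap 0 2 * swap 1 3, ?_, ?_, ?_⟩
      · have h4 : (swap 0 1 * swap 2 3 * (swap 0 2 * swap 1 3) : Perm (Fin 4)) =
          swap 0 3 * swap 1 2 := by decide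
        rw [h4, parts_partition, ← sum_cycleType, cycleType_swap_mul_swap_of_nodup (by decide)]
        rfl
      · rw [cycleType_swap_mul_swap_of_nodup (by decide)]
        rfl
      · rw [cycleType_swap_mul_swap_of_nodup (by decide)]
        rfl
    · have h1 : IsFactorType {4 + 2 * t} t 1 (t + 1) := by
        simpa [add_comm 1] using isFactorType_of_odd 1 0 t
      rw [show 4 + 2 * t = 2 + 2 * (t + 1) by ring] at h1
      refine ⟨2 * t + 2, 1, 0, ?_, ?_⟩
      · rw [hkk]
        convert h.add h1 using 1 <;> ring
      · rw [hkk]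
        convert h.add h.symm using 1 <;> ring

end Factorization

section Absorber
variable {M₂ M₃ : ℕ}

theorem exists_dvd_add_mul (h : Nat.Coprime M₂ M₃) (h2 : 0 < M₂) (z : ℤ) :
    ∃ j : ℕ, 1 ≤ j ∧ j ≤ M₂ ∧ (M₂ : ℤ) ∣ z + M₃ * j := by
  obtain ⟨u, v, huv⟩ := Nat.isCoprime_iff_coprime.2 h
  have h2' : (M₂ : ℤ) ≠ 0 := by positivity
  have hn := Int.emod_nonneg (-z * v - 1) h2'
  have hlt := Int.emod_lt_of_pos (-z * v - 1) (show (0 : ℤ) < M₂ by positivity)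
  refine ⟨((-z * v - 1) % M₂).toNat + 1, by omega, by omega, ?_⟩
  push_cast
  rw [Int.toNat_of_nonneg hn]
  have hd := Int.emod_add_mul_ediv (-z * v - 1) M₂
  refine ⟨u * z - M₃ * ((-z * v - 1) / M₂), ?_⟩
  linear_combination (-z) * huv + M₃ * hd

/-- Permutations with orbit sizes `m` can be factored with prescribed numbers of two-cycles
modulo `M₂`, up to the shift `δ`, and with the number of three-cycles divisible by `M₃`. -/
def IsAbsorber (M₂ M₃ δ : ℕ) (m : Multiset ℕ) : Prop :=
  ∀ b : ℕ, ∃ a e c, IsFactorType m (a + δ) e c ∧ M₂ ∣ a + b ∧ M₂ ∣ c + b ∧ M₃ ∣ e ∧ 0 < a + δ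

theorem isAbsorber_replicate (h : Nat.Coprime M₂ M₃) (h2 : 0 < M₂) (h3 : 0 < M₃) {k : ℕ}
    (hk : 0 < k) : IsAbsorber M₂ M₃ 0 (Multiset.replicate (2 * (M₂ * M₃)) k) := by
  intro b
  obtain ⟨c, e, e', hc, hc'⟩ := exists_isFactorType_pair hk
  obtain ⟨j, hj1, hj2, hj⟩ := exists_dvd_add_mul h h2 b
  obtain ⟨i, rfl⟩ := Nat.exists_eq_add_of_le hj2
  have hf := (hc.nsmul (M₃ * i)).add (hc'.nsmul (M₃ * j))
  have hkk : ({k, k} : Multiset ℕ) = Multiset.replicate 2 k := rfl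
  rw [hkk, Multiset.nsmul_replicate, Multiset.nsmul_replicate, ← Multiset.replicate_add,
    show M₃ * i * 2 + M₃ * j * 2 = 2 * ((j + i) * M₃) by ring] at hf
  have hd : j + i ∣ M₃ * i * c + M₃ * j * (c + 1) + b := by
    have : M₃ * i * c + M₃ * j * (c + 1) + b = (j + i) * (M₃ * c) + (b + M₃ * j) := by ring
    rw [this]
    exact dvd_add (dvd_mul_right _ _) (by exact_mod_cast hj)
  refine ⟨_, _, _, hf, hd, hd, ?_,
    show 0 < M₃ * i * c + M₃ * j * (c + 1) from
      Nat.add_pos_right _ (Nat.mul_pos (Nat.mul_pos h3 hj1) c.succ_pos)⟩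
  exact dvd_add (by rw [mul_assoc]; exact dvd_mul_right _ _)
    (by rw [mul_assoc]; exact dvd_mul_right _ _)

theorem exists_isAbsorber_singleton (h : Nat.Coprime M₂ M₃) (h2 : 0 < M₂) {k : ℕ}
    (hk : 6 * (M₂ * M₃) + 4 ≤ k) : ∃ δ < 2, IsAbsorber M₂ M₃ δ {k} := by
  obtain ⟨δ, u, hδ, rfl⟩ : ∃ δ u, δ < 2 ∧ k = 1 + δ + 4 * (M₂ * M₃) + 2 * u :=
    ⟨(k - 1) % 2, (k - 1) / 2 - 2 * (M₂ * M₃), by omega, by omega⟩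
  refine ⟨δ, hδ, fun b => ?_⟩
  obtain ⟨j, hj1, hj2, hj⟩ := exists_dvd_add_mul h h2 (-(u + b))
  obtain ⟨i, rfl⟩ := Nat.exists_eq_add_of_le hj2
  have hle : (j + i) * M₃ = M₃ * j + M₃ * i := by ring
  obtain ⟨t, rfl⟩ := Nat.exists_eq_add_of_le (show M₃ * j ≤ u by omega)
  have ht : 0 < t := by omega
  have hd : j + i ∣ t + b := by
    have : (-((M₃ * j + t : ℕ) + b) + M₃ * j : ℤ) = -(t + b : ℕ) := by
      push_cast
      ring
    rw [this, dvd_neg] at hj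
    exact_mod_cast hj
  have hf : IsFactorType {1 + δ + 4 * ((j + i) * M₃) + 2 * (M₃ * j + t)} (t + δ)
      (2 * M₃ * j + M₃ * i) (2 * M₃ * j + 2 * (M₃ * i) + t) := by
    rw [show 1 + δ + 4 * ((j + i) * M₃) + 2 * (M₃ * j + t) =
      1 + δ + 3 * (2 * M₃ * j) + 4 * (M₃ * i) + 2 * t by ring]
    interval_cases δ
    · exact isFactorType_of_odd _ _ _
    · exact isFactorType_of_even _ _ _
  refine ⟨_, _, _, hf, hd, ?_, ?_, by omega⟩
  · rw [show 2 * M₃ * j + 2 * (M₃ * i) + t + b = (j + i) * (2 * M₃) + (t + b) by ring]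
    exact dvd_add (dvd_mul_right _ _) hd
  · exact dvd_add (by rw [mul_comm 2, mul_assoc]; exact dvd_mul_right _ _) (dvd_mul_right _ _)

theorem exists_le_isAbsorber (h : Nat.Coprime M₂ M₃) (h2 : 0 < M₂) (h3 : 0 < M₃) :
    ∃ N, ∀ m : Multiset ℕ, (∀ k ∈ m, 0 < k) → N ≤ m.sum →
      ∃ m₁ ≤ m, ∃ δ < 2, IsAbsorber M₂ M₃ δ m₁ := by
  set K := 6 * (M₂ * M₃) + 4 with hK
  refine ⟨K * (2 * (M₂ * M₃) * K) + 1, fun m hm hN => ?_⟩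
  by_contra! hcon
  have hlt : ∀ k ∈ m, k < K := fun k hk => by
    by_contra! hKk
    obtain ⟨δ, hδ, hab⟩ := exists_isAbsorber_singleton h h2 hKk
    exact hcon _ (Multiset.singleton_le.2 hk) δ hδ hab
  have hcount : ∀ k ∈ m, m.count k ≤ 2 * (M₂ * M₃) := fun k hk => by
    by_contra! hc
    exact hcon _ (Multiset.le_count_iff_replicate_le.1 hc.le) 0 two_pos
      (isAbsorber_replicate h h2 h3 (hm k hk))
  have hsub : m.toFinset ⊆ Finset.range K := fun k hk =>
    Finset.mem_range.2 (hlt k (Multiset.mem_toFinset.1 hk))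
  have hsum : m.sum ≤ ∑ k ∈ m.toFinset, 2 * (M₂ * M₃) * K := by
    rw [Finset.sum_multiset_count]
    refine Finset.sum_le_sum fun k hk => ?_
    rw [Multiset.mem_toFinset] at hk
    exact Nat.mul_le_mul (hcount k hk) (hlt k hk).le
  have hcard := Finset.card_le_card hsub
  rw [Finset.card_range] at hcard
  rw [Finset.sum_const, smul_eq_mul] at hsum
  have := Nat.mul_le_mul_right (2 * (M₂ * M₃) * K) hcard
  omega

/-- An even permutation of many points is the product of a permutation whose numbers of two- and
three-cycles are divisible by `M₂` and `M₃`, and of an involution with number of two-cycles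
divisible by `M₂`. -/
theorem exists_eq_mul_of_sign_eq_one (h : Nat.Coprime M₂ M₃) (h2 : 0 < M₂) (hM : 2 ∣ M₂)
    (h3 : 0 < M₃) : ∃ N, ∀ (β : Type) [Fintype β] [DecidableEq β] (g : Perm β),
      N ≤ Fintype.card β → sign g = 1 → ∃ (x y : Perm β) (i j l : ℕ), g = x * y ∧ 0 < i ∧
        x.cycleType = Multiset.replicate (M₂ * i) 2 + Multiset.replicate (M₃ * j) 3 ∧
        y.cycleType = Multiset.replicate (M₂ * l) 2 := by
  obtain ⟨N, hN⟩ := exists_le_isAbsorber h h2 h3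
  refine ⟨N, fun β _ _ g hβ hg => ?_⟩
  have hpos : ∀ k ∈ g.partition.parts, 0 < k := fun k hk => g.partition.parts_pos hk
  obtain ⟨m, hm, δ, hδ, hab⟩ := hN g.partition.parts hpos (by rwa [g.partition.parts_sum])
  obtain ⟨m', hm'⟩ := Multiset.le_iff_exists_add.1 hm
  obtain ⟨b, hb⟩ := exists_isFactorType m' fun k hk =>
    hpos k (by rw [hm']; exact Multiset.mem_add.2 (Or.inr hk))
  have key : ∃ a e c, IsFactorType g.partition.parts a e c ∧ M₂ ∣ a ∧ M₃ ∣ e ∧ M₂ ∣ c ∧ 0 < a := by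
    have hodd : ∀ {a e c}, IsFactorType g.partition.parts a e c → ¬ Odd (a + c) := by
      intro a e c hf ho
      have := hf.sign_eq rfl
      rw [hg, ho.neg_one_pow] at this
      exact absurd this (by decide)
    interval_cases δ
    · obtain ⟨a, e, c, hf, ha, hc, he, h0⟩ := hab b
      have hac : 2 ∣ a + b ∧ 2 ∣ c + b := ⟨hM.trans ha, hM.trans hc⟩
      rcases hb with hb | hb
      · exact ⟨_, _, _, hm' ▸ hf.add hb, ha, he, hc, by omega⟩
      · refine absurd ?_ (hodd (hm' ▸ hf.add hb))
        rw [Nat.odd_iff]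
        omega
    · obtain ⟨a, e, c, hf, ha, hc, he, h0⟩ := hab (b + 1)
      have hac : 2 ∣ a + (b + 1) ∧ 2 ∣ c + (b + 1) := ⟨hM.trans ha, hM.trans hc⟩
      rcases hb with hb | hb
      · refine absurd ?_ (hodd (hm' ▸ hf.add hb))
        rw [Nat.odd_iff]
        omega
      · refine ⟨_, _, _, hm' ▸ hf.add hb.symm, ?_, he, hc, by omega⟩
        rwa [add_assoc, add_comm 1]
  obtain ⟨a, e, c, hf, ⟨i, rfl⟩, ⟨j, rfl⟩, ⟨l, rfl⟩, ha⟩ := key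
  obtain ⟨x, y, hxy, hx, hy⟩ := hf.exists_mul_eq rfl
  exact ⟨x, y, i, j, l, hxy, Nat.pos_of_mul_pos_left ha, hx, hy⟩

end Absorber

section Assembly

theorem exists_apply_of_cycleType {α : Type*} [Fintype α] [DecidableEq α] {x : Perm α}
    {s : Multiset ℕ} {n : ℕ} (hx : x.cycleType = Multiset.replicate n 2 + s) (hn : 2 ≤ n) :
    ∃ p q r t, [p, q, r, t].Nodup ∧ x p = q ∧ x q = p ∧ x r = t ∧ x t = r := by
  have hcount : 2 ≤ (x.cycleFactorsFinset.filter fun c => 2 = c.support.card).card := by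
    have h2 := congrArg (Multiset.count 2) hx
    rw [cycleType_def, Multiset.count_map, Multiset.count_add, Multiset.count_replicate_self] at h2
    refine hn.trans (Nat.le_of_add_right_le h2.ge)
  obtain ⟨c, hc, c', hc', hne⟩ := Finset.one_lt_card.1 hcount
  rw [Finset.mem_filter] at hc hc'
  have hd := x.cycleFactorsFinset_pairwise_disjoint hc.1 hc'.1 hne
  obtain ⟨p, q, hpq, rfl⟩ := card_support_eq_two.1 hc.2.symm
  obtain ⟨r, t, hrt, rfl⟩ := card_support_eq_two.1 hc'.2.symm
  have h := (mem_cycleFactorsFinset_iff.1 hc.1).2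
  have h' := (mem_cycleFactorsFinset_iff.1 hc'.1).2
  have hdis := hd.disjoint_support
  rw [support_swap hpq] at h hdis
  rw [support_swap hrt] at h' hdis
  refine ⟨p, q, r, t, ?_, ?_, ?_, ?_, ?_⟩
  · simp at hdis ⊢
    grind
  · rw [← h p (by simp), swap_apply_left]
  · rw [← h q (by simp), swap_apply_right]
  · rw [← h' r (by simp), swap_apply_left]
  · rw [← h' t (by simp), swap_apply_right]

theorem mul_mem_wordImage {d : ℕ} {w : FreeGroup (Fin d)} {G : Type*} [Group G] {a : G}
    (ha : a ∈ wordImage w G) (g : G) : g * a * g⁻¹ ∈ wordImage w G := by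
  obtain ⟨f, rfl⟩ := ha
  refine ⟨fun i => g * f i * g⁻¹, ?_⟩
  have : FreeGroup.lift (fun i => g * f i * g⁻¹) =
      (MulAut.conj g).toMonoidHom.comp (FreeGroup.lift f) := by
    ext i : 1
    simp
  simp only [this]
  rfl

theorem IsAltCover.exists_mem_wordImage {d : ℕ} {w : FreeGroup (Fin d)} {G α : Type*} [Group G]
    [Fintype α] [DecidableEq α] {π : G →* Perm α} (hπ : IsAltCover π) {s : Multiset ℕ}
    (hs : IsWordCycleType w s) {x : Perm α} (hx : x.cycleType = s) :
    ∃ a ∈ wordImage w G, π a = x := by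
  obtain ⟨f, hf, rfl⟩ := hs.exists_lift_eq hx
  choose F hF using fun i => hπ.exists_map_eq (f i) (hf i)
  refine ⟨_, ⟨F, rfl⟩, ?_⟩
  have : π.comp (FreeGroup.lift F) = FreeGroup.lift f := by
    ext i : 1
    simp [hF]
  rw [← this]
  rfl

theorem exists_isAltCover {G α : Type*} [Group G] [Fintype α] [DecidableEq α]
    (φ : (G ⧸ Subgroup.center G) ≃* alternatingGroup α) : ∃ π : G →* Perm α, IsAltCover π := by
  refine ⟨(alternatingGroup α).subtype.comp
    (φ.toMonoidHom.comp (QuotientGroup.mk' (Subgroup.center G))), fun σ hσ => ?_, fun g => ?_,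
    fun g hg => ?_⟩
  · obtain ⟨q, hq⟩ := φ.surjective ⟨σ, hσ⟩
    obtain ⟨g, rfl⟩ := QuotientGroup.mk_surjective q
    exact ⟨g, congrArg Subtype.val hq⟩
  · exact (φ (g : G ⧸ Subgroup.center G)).2
  · have h1 : φ (g : G ⧸ Subgroup.center G) = 1 := Subtype.ext hg
    rwa [map_eq_one_iff _ φ.injective, QuotientGroup.eq_one_iff] at h1

end Assembly

theorem stmt1 {d1 d2 : ℕ} (w1 : FreeGroup (Fin d1)) (w2 : FreeGroup (Fin d2))
    (hw1 : w1 ≠ 1) (hw2 : w2 ≠ 1) :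
    ∃ N : ℕ, ∀ n : ℕ, N ≤ n → ∀ (G : Type) [Group G] [Fintype G], IsQuasisimple G →
      Nonempty ((G ⧸ Subgroup.center G) ≃* alternatingGroup (Fin n)) →
      ∀ g : G, ∃ a ∈ wordImage w1 G, ∃ b ∈ wordImage w2 G, g = a * b := by
  obtain ⟨u₁, hu₁⟩ := exists_isWordCycleType_two hw1
  obtain ⟨u₂, hu₂⟩ := exists_isWordCycleType_two hw2
  obtain ⟨v₁, hv₁⟩ := exists_isWordCycleType_three hw1
  obtain ⟨N, hN⟩ := exists_eq_mul_of_sign_eq_one (M₂ := 2 ^ (u₁ + 1) * 2 ^ (u₂ + 1))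
    (M₃ := 3 ^ v₁) (Nat.Coprime.pow_right _ (Nat.Coprime.mul_left
      (Nat.Coprime.pow_left _ (by norm_num)) (Nat.Coprime.pow_left _ (by norm_num))))
    (by positivity) (Dvd.dvd.mul_right (dvd_pow_self 2 (Nat.succ_ne_zero _)) _) (by positivity)
  refine ⟨max N 8, fun n hn G _ _ hG ⟨φ⟩ g => ?_⟩
  obtain ⟨π, hπ⟩ := exists_isAltCover φ
  obtain ⟨x, y, i, j, l, hxy, hi, hx, hy⟩ := hN (Fin n) (π g)
    (by rw [Fintype.card_fin]; exact (le_max_left _ _).trans hn) (hπ.sign_map g)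
  have hwx := (hu₁.nsmul (2 ^ (u₂ + 1) * i)).add (hv₁.nsmul j)
  have hwy := hu₂.nsmul (2 ^ (u₁ + 1) * l)
  rw [Multiset.nsmul_replicate, Multiset.nsmul_replicate] at hwx
  rw [Multiset.nsmul_replicate] at hwy
  obtain ⟨a, ha, hax⟩ := hπ.exists_mem_wordImage hwx (by rw [hx]; congr 2 <;> ring)
  obtain ⟨b, hb, hby⟩ := hπ.exists_mem_wordImage hwy (by rw [hy]; congr 1; ring)
  obtain ⟨p, q, r, t, hd, hp, hq, hr, ht⟩ := exists_apply_of_cycleType hx (by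
    rw [pow_succ, mul_comm _ 2, mul_assoc, mul_assoc]
    exact Nat.le_mul_of_pos_right 2 (by positivity))
  have hζ : π (a⁻¹ * g * b⁻¹) = 1 := by
    rw [map_mul, map_mul, hxy, map_inv, map_inv, hax, hby]
    group
  subst hax
  obtain ⟨k, hk⟩ := hπ.exists_conj_eq_mul (by
    rw [Fintype.card_fin]; exact (le_max_right _ _).trans hn) hG.1 hd hp hq hr ht hζ
  refine ⟨_, mul_mem_wordImage ha k, b, hb, ?_⟩
  rw [hk]
  group
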